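/- Suppose ζ₁,…,ζ_d and ζ̃₁,…,ζ̃_d are compactly supported elements of L²(ℝⁿ) that form dual G-frames for a closed subspace K ⊆ L²(ℝⁿ). Then there exist r ∈ ℕ and compactly supported η₁,…,η_r and η̃₁,…,η̃_r in K that form bi-orthogonal dual G-frames for K, i.e. they form dual G-frames for K and ⟨ν_g ηᵢ, ν_{g'} η̃ⱼ⟩ = δ_{g,g'} δ_{i,j} for all g, g' ∈ ℤⁿ and all i, j. -/

import Mathlib

/- STATEMENT 11: If ζ₁,…,ζ_d and ζ̃₁,…,ζ̃_d are compactly supported and form dual G-frames for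
a closed subspace K ⊆ L²(ℝⁿ), then there exist compactly supported η₁,…,η_r, η̃₁,…,η̃_r in K
forming bi-orthogonal dual G-frames for K. -/

open MeasureTheory
open scoped ComplexConjugate

noncomputable section

/-- The inner product with the paper's convention: linear in the first variable,
conjugate-linear in the second. -/
def ipp {H : Type*} [NormedAddCommGroup H] [InnerProductSpace ℂ H] (x y : H) : ℂ :=
  @inner ℂ _ _ y x

/-- `L²(ℝⁿ)` with Lebesgue measure. -/
abbrev L2Rn (n : ℕ) : Type := Lp ℂ 2 (volume : Measure (Fin n → ℝ))

/-- An element of `L²(ℝⁿ)` is compactly supported if it vanishes a.e. outside a compact set. -/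
def CompSupp {n : ℕ} (ζ : L2Rn n) : Prop :=
  ∃ K : Set (Fin n → ℝ), IsCompact K ∧ ∀ᵐ x : Fin n → ℝ, x ∉ K → ζ x = 0

/-- `ζ₁,…,ζ_d` form a `G`-frame (`G = ℤⁿ`) for `K`. -/
def IsGFrame {n : ℕ} (ν : (Fin n → ℤ) → (L2Rn n ≃ₗᵢ[ℂ] L2Rn n)) {d : ℕ}
    (ζs : Fin d → L2Rn n) (K : Set (L2Rn n)) : Prop :=
  (∀ (g : Fin n → ℤ) (i : Fin d), (ν g (ζs i) : L2Rn n) ∈ K) ∧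
  ∃ A B : ℝ, 0 < A ∧ 0 < B ∧ ∀ ζ ∈ K,
    A * ‖ζ‖ ^ 2 ≤ (∑' g : Fin n → ℤ, ∑ i, ‖ipp ζ (ν g (ζs i))‖ ^ 2) ∧
    (∑' g : Fin n → ℤ, ∑ i, ‖ipp ζ (ν g (ζs i))‖ ^ 2) ≤ B * ‖ζ‖ ^ 2

/-- `ζ₁,…,ζ_d` and `ζ̃₁,…,ζ̃_d` form dual `G`-frames for `K`. -/
def DualGFrames {n : ℕ} (ν : (Fin n → ℤ) → (L2Rn n ≃ₗᵢ[ℂ] L2Rn n)) {d : ℕ}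
    (ζs ζt : Fin d → L2Rn n) (K : Set (L2Rn n)) : Prop :=
  IsGFrame ν ζs K ∧ IsGFrame ν ζt K ∧
  ∀ ζ ∈ K,
    HasSum (fun p : (Fin n → ℤ) × Fin d =>
      ipp ζ (ν p.1 (ζs p.2)) • (ν p.1 (ζt p.2) : L2Rn n)) ζ ∧
    HasSum (fun p : (Fin n → ℤ) × Fin d =>
      ipp ζ (ν p.1 (ζt p.2)) • (ν p.1 (ζs p.2) : L2Rn n)) ζ

/-- Bi-orthogonality of two families under the translation action. -/
def BiOrth {n : ℕ} (ν : (Fin n → ℤ) → (L2Rn n ≃ₗᵢ[ℂ] L2Rn n)) {d : ℕ}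
    (ζs ζt : Fin d → L2Rn n) : Prop :=
  ∀ (g g' : Fin n → ℤ) (i j : Fin d),
    ipp (ν g (ζs i) : L2Rn n) (ν g' (ζt j) : L2Rn n) = if g = g' ∧ i = j then 1 else 0

/-- Two vectors over a commutative ring lie in the same orbit of the general linear group. -/
def RowEquiv {ι A : Type*} [Fintype ι] [DecidableEq ι] [CommRing A] (v w : ι → A) : Prop :=
  ∃ M : Matrix ι ι A, IsUnit M.det ∧ M.mulVec v = w

namespace RowEquiv

open Matrix

variable {ι A B : Type*} [Fintype ι] [DecidableEq ι] [CommRing A] [CommRing B]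

theorem refl (v : ι → A) : RowEquiv v v := ⟨1, by simp, by simp⟩

theorem symm {v w : ι → A} (h : RowEquiv v w) : RowEquiv w v := by
  obtain ⟨M, hM, rfl⟩ := h
  exact ⟨M⁻¹, by simpa using hM, by simp [Matrix.nonsing_inv_mul M hM]⟩

theorem trans {u v w : ι → A} (h : RowEquiv u v) (h' : RowEquiv v w) : RowEquiv u w := by
  obtain ⟨M, hM, rfl⟩ := h
  obtain ⟨N, hN, rfl⟩ := h'
  exact ⟨N * M, by simpa using ⟨hN, hM⟩, by simp⟩

theorem map (φ : A →+* B) {v w : ι → A} (h : RowEquiv v w) :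
    RowEquiv (fun i => φ (v i)) (fun i => φ (w i)) := by
  obtain ⟨M, hM, rfl⟩ := h
  refine ⟨M.map φ, ?_, ?_⟩
  · have := hM.map φ
    rwa [RingHom.map_det] at this
  · ext i
    simp [Matrix.mulVec, dotProduct]

theorem unimodular {v w : ι → A} (h : RowEquiv v w) (hv : ∃ y : ι → A, y ⬝ᵥ v = 1) :
    ∃ y : ι → A, y ⬝ᵥ w = 1 := by
  obtain ⟨M, hM, rfl⟩ := h
  obtain ⟨y, hy⟩ := hv
  refine ⟨vecMul y M⁻¹, ?_⟩
  rw [dotProduct_mulVec, vecMul_vecMul, Matrix.nonsing_inv_mul M hM, vecMul_one, hy]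

theorem of_diagonal (u : ι → Aˣ) (v : ι → A) : RowEquiv v (fun i => u i * v i) := by
  refine ⟨Matrix.diagonal fun i => (u i : A), ?_, ?_⟩
  · rw [Matrix.det_diagonal]
    exact IsUnit.prod_univ_iff.2 fun i => (u i).isUnit
  · ext i
    simp [Matrix.mulVec_diagonal]

theorem transvection (v u w : ι → A) (h : w ⬝ᵥ u = 0) : RowEquiv v (v + (w ⬝ᵥ v) • u) := by
  refine ⟨1 + vecMulVec u w, ?_, ?_⟩
  · rw [vecMulVec_eq Unit, Matrix.det_one_add_replicateCol_mul_replicateRow, h]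
    simp
  · rw [Matrix.add_mulVec, Matrix.one_mulVec, Matrix.vecMulVec_mulVec]
    simp

/-- If an entry is a unit, the vector can be moved to a standard basis vector. -/
theorem single_of_isUnit (v : ι → A) (i : ι) (h : IsUnit (v i)) :
    RowEquiv v (Pi.single i 1) := by
  obtain ⟨u, hu⟩ := h
  have h1 := transvection v (Pi.single i (v i) - v) (Pi.single i (↑u⁻¹ : A)) (by simp)
  have h2 : v + ((Pi.single i (↑u⁻¹ : A) : ι → A) ⬝ᵥ v) • (Pi.single i (v i) - v) =
      Pi.single i (v i) := by
    simp [← hu]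
  rw [h2] at h1
  refine h1.trans ?_
  convert of_diagonal (fun _ => u⁻¹) (Pi.single i (v i)) using 1
  ext j
  by_cases hj : j = i
  · subst hj
    simp [← hu]
  · simp [hj]

/-- Moving a vector within its class modulo a scalar `c` lying in the ideal generated by two of its
entries, both before and after the move. -/
theorem of_dvd [IsDomain A] (v v' : ι → A) {i j : ι} (hij : i ≠ j) {c a b a' b' : A}
    (h : a * v i + b * v j = c) (h' : a' * v' i + b' * v' j = c)
    (ha : c ∣ a' - a) (hb : c ∣ b' - b) (hv : ∀ k, c ∣ v' k - v k) : RowEquiv v v' := by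
  rcases eq_or_ne c 0 with rfl | hc
  · have : v' = v := funext fun k => sub_eq_zero.1 (zero_dvd_iff.1 (hv k))
    rw [this]
    exact refl v
  obtain ⟨e, he⟩ := ha
  obtain ⟨f, hf⟩ := hb
  choose d hd using hv
  have hvi : v' i = v i + c * d i := by linear_combination hd i
  have hvj : v' j = v j + c * d j := by linear_combination hd j
  let U : Matrix ι (Fin 2) A :=
    Matrix.of fun k => ![d k, (Pi.single i (-f) + Pi.single j e : ι → A) k]
  let W : Matrix (Fin 2) ι A :=
    Matrix.of ![Pi.single i a + Pi.single j b, Pi.single i (-v j) + Pi.single j (v i)]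
  refine ⟨1 + U * W, ?_, ?_⟩
  · suffices h1 : (1 + U * W).det = 1 by rw [h1]; exact isUnit_one
    rw [Matrix.det_one_add_mul_comm]
    have hji := hij.symm
    have hWU : W * U = !![a * d i + b * d j, -(a * f) + b * e;
        -(v j * d i) + v i * d j, v j * f + v i * e] := by
      ext k l
      fin_cases k <;> fin_cases l <;>
        simp [U, W, Matrix.mul_apply, add_mul, Finset.sum_add_distrib, Pi.single_apply, hij, hji]
    rw [hWU, Matrix.one_fin_two]
    simp only [Matrix.of_add_of, Matrix.add_cons, Matrix.head_cons, Matrix.tail_cons,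
      Matrix.empty_add_empty, Matrix.det_fin_two_of]
    have key : c * (a * d i + b * d j + e * v i + f * v j + c * (e * d i + f * d j)) = 0 := by
      have ha' : a' = a + c * e := by linear_combination he
      have hb' : b' = b + c * f := by linear_combination hf
      rw [ha', hb', hvi, hvj] at h'
      linear_combination h' - h
    have key' := (mul_eq_zero.1 key).resolve_left hc
    linear_combination key' + (e * d i + f * d j) * h
  · rw [Matrix.add_mulVec, Matrix.one_mulVec, ← Matrix.mulVec_mulVec]
    have hW : W.mulVec v = ![c, 0] := by
      ext k
      fin_cases k
      · change (Pi.single i a + Pi.single j b : ι → A) ⬝ᵥ v = c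
        rw [add_dotProduct, single_dotProduct, single_dotProduct, h]
      · change (Pi.single i (-v j) + Pi.single j (v i) : ι → A) ⬝ᵥ v = 0
        rw [add_dotProduct, single_dotProduct, single_dotProduct]
        ring
    rw [hW]
    ext k
    simp [U]
    linear_combination -hd k

end RowEquiv

/-- In a principal ideal domain, if `a ≠ 0` and no prime divides `a`, `b` and `c`, then some
`b + h * c` is coprime to `a`. -/
theorem exists_isCoprime_add_mul {S : Type*} [CommRing S] [IsDomain S] [IsPrincipalIdealRing S]
    (a b c : S) (ha : a ≠ 0) (h : ∀ p, Prime p → p ∣ a → p ∣ b → ¬ p ∣ c) :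
    ∃ t, IsCoprime a (b + t * c) := by
  induction a using UniqueFactorizationMonoid.induction_on_prime with
  | h₁ => exact absurd rfl ha
  | h₂ x hx => exact ⟨0, hx.exists_left_inv.elim fun y hy => ⟨y, 0, by simp [hy]⟩⟩
  | h₃ a p ha0 hp ih =>
    obtain ⟨t, ht⟩ := ih ha0 fun q hq hqa => h q hq (hqa.mul_left p)
    have hirr := hp.irreducible
    by_cases hd : p ∣ b + t * c
    · have hpa : ¬ p ∣ a := fun hpa => hp.not_isUnit (ht.isUnit_of_dvd' hpa hd)
      have hpc : ¬ p ∣ c := fun hpc =>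
        h p hp (dvd_mul_right p a) ((dvd_add_left (hpc.mul_left t)).1 hd) hpc
      refine ⟨t + a, IsCoprime.mul_left ?_ ?_⟩
      · refine (hirr.coprime_iff_not_dvd).2 fun hdvd => ?_
        have : p ∣ a * c := (dvd_add_right hd).1 (by convert hdvd using 1; ring)
        exact (hp.dvd_or_dvd this).elim hpa hpc
      · have := ht.add_mul_left_right c
        convert this using 1
        ring
    · exact ⟨t, IsCoprime.mul_left ((hirr.coprime_iff_not_dvd).2 hd) ht⟩

namespace RowEquiv

open Matrix Polynomial

variable {ι R : Type*} [Fintype ι] [DecidableEq ι] [CommRing R]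

/-- The constants `c` such that substituting polynomials congruent modulo `c` into `f` yields
equivalent rows. -/
def substIdeal (f : ι → R[X]) : Ideal R where
  carrier := {c | ∀ b b' : R[X], C c ∣ b' - b →
    RowEquiv (fun i => (f i).comp b) (fun i => (f i).comp b')}
  zero_mem' := fun b b' h => by
    have : b' = b := by simpa [sub_eq_zero] using h
    rw [this]
    exact refl _
  add_mem' := by
    rintro c d hc hd b b' ⟨y, hy⟩
    refine (hc b (b + C c * y) (by simp)).trans (hd _ b' ⟨y, ?_⟩)
    rw [map_add] at hy
    linear_combination hy
  smul_mem' := by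
    rintro r c hc b b' h
    refine hc b b' (dvd_trans ?_ h)
    simp

theorem substIdeal_mono {f F : ι → R[X]} (h : RowEquiv f F) : substIdeal F ≤ substIdeal f := by
  intro c hc b b' hb
  exact ((h.map (compRingHom b)).trans (hc b b' hb)).trans (h.map (compRingHom b')).symm

theorem mem_substIdeal_of_eq_add [IsDomain R] (f : ι → R[X]) {i j : ι} (hij : i ≠ j) {c : R}
    {a b : R[X]} (h : a * f i + b * f j = C c) : c ∈ substIdeal f := by
  intro x y hxy
  have hdvd : ∀ q : R[X], C c ∣ q.comp y - q.comp x := fun q =>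
    hxy.trans (by
      simpa only [Polynomial.comp, eval₂_eq_eval_map] using sub_dvd_eval_sub y x (q.map C))
  have hc (z : R[X]) : a.comp z * (f i).comp z + b.comp z * (f j).comp z = C c := by
    simpa using congrArg (fun q => q.comp z) h
  exact of_dvd _ _ hij (hc x) (hc y) (hdvd a) (hdvd b) fun k => hdvd (f k)

/-- If a monic polynomial and another polynomial generate the unit ideal modulo a maximal ideal
`m`, the ideal they generate contains a constant outside `m`. -/
theorem exists_notMem_C_eq {m : Ideal R} (hm : m.IsMaximal) {p q : R[X]} (hp : p.Monic)
    (h : IsCoprime (p.map (Ideal.Quotient.mk m)) (q.map (Ideal.Quotient.mk m))) :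
    ∃ c, c ∉ m ∧ ∃ a b, a * p + b * q = C c := by
  let J : Ideal R[X] := Ideal.span {p, q}
  have hfin : Module.Finite R (R[X] ⧸ J) := by
    have := hp.finite_quotient
    have hle : Ideal.span {p} ≤ J := Ideal.span_mono (by simp)
    exact Module.Finite.of_surjective (Ideal.Quotient.factorₐ R hle).toLinearMap
      (Ideal.Quotient.factor_surjective hle)
  have htop : (⊤ : Submodule R (R[X] ⧸ J)) ≤ m • (⊤ : Submodule R (R[X] ⧸ J)) := by
    obtain ⟨u, v, huv⟩ := h
    obtain ⟨u, rfl⟩ := Polynomial.map_surjective _ Ideal.Quotient.mk_surjective u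
    obtain ⟨v, rfl⟩ := Polynomial.map_surjective _ Ideal.Quotient.mk_surjective v
    have h1 : 1 - (u * p + v * q) ∈ Ideal.map (C : R →+* R[X]) m := by
      refine Ideal.mem_map_C_iff.2 fun n => ?_
      rw [← Ideal.Quotient.eq_zero_iff_mem, ← coeff_map, Polynomial.map_sub, Polynomial.map_add,
        Polynomial.map_mul, Polynomial.map_mul, huv]
      simp
    intro x _
    obtain ⟨g, rfl⟩ := Ideal.Quotient.mk_surjective x
    rw [Ideal.smul_top_eq_map, IsScalarTower.algebraMap_eq R R[X], ← Ideal.map_map]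
    have h2 : Ideal.Quotient.mk J g = Ideal.Quotient.mk J (g * (1 - (u * p + v * q))) := by
      rw [Ideal.Quotient.mk_eq_mk_iff_sub_mem]
      exact Ideal.mem_span_pair.2 ⟨g * u, g * v, by ring⟩
    rw [h2]
    exact Ideal.mem_map_of_mem _ (Ideal.mul_mem_left _ _ h1)
  obtain ⟨r, hr, hr'⟩ := Submodule.exists_sub_one_mem_and_smul_eq_zero_of_fg_of_le_smul m _
    hfin.fg_top htop
  refine ⟨r, fun hrm => hm.ne_top ((Ideal.eq_top_iff_one _).2 ?_), ?_⟩
  · have := m.sub_mem hrm hr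
    simpa using this
  · have h1 := hr' 1 trivial
    have : C r ∈ J := by
      rw [← Ideal.Quotient.eq_zero_iff_mem, ← h1]
      change Ideal.Quotient.mk J (C r) = Ideal.Quotient.mk J (r • 1)
      rw [smul_eq_C_mul, mul_one]
    exact Ideal.mem_span_pair.1 this

theorem exists_mem_substIdeal_notMem [IsDomain R] (f : ι → R[X]) {i j : ι} (hij : i ≠ j)
    (hi : (f i).Monic) (hf : ∃ y : ι → R[X], y ⬝ᵥ f = 1) {m : Ideal R} (hm : m.IsMaximal) :
    ∃ c ∈ substIdeal f, c ∉ m := by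
  let φ := Ideal.Quotient.mk m
  let _ := Ideal.Quotient.field m
  let s : Finset ι := {k | k ≠ i ∧ k ≠ j}
  obtain ⟨c, hc⟩ := (IsPrincipalIdealRing.principal
    (Ideal.span ((fun k => (f k).map φ) '' (s : Set ι)))).principal
  rw [Ideal.submodule_span_eq] at hc
  have hcmem : c ∈ Ideal.span ((fun k => (f k).map φ) '' (s : Set ι)) := by
    rw [hc]; exact Ideal.mem_span_singleton_self c
  obtain ⟨q, hq⟩ : ∃ q : ι → (R ⧸ m)[X], ∑ k ∈ s, q k * (f k).map φ = c := by
    obtain ⟨q, hq⟩ := (Submodule.mem_span_image_finset_iff_exists_fun _).1 hcmem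
    refine ⟨fun k => if h : k ∈ s then q ⟨k, h⟩ else 0, ?_⟩
    rw [← hq, ← Finset.sum_coe_sort s]
    exact Finset.sum_congr rfl fun k _ => by simp
  obtain ⟨y, hy⟩ := hf
  obtain ⟨t, ht⟩ := exists_isCoprime_add_mul ((f i).map φ) ((f j).map φ) c
    (hi.map φ).ne_zero fun p hp hpi hpj hpc => hp.not_isUnit <| isUnit_of_dvd_one <| by
      have hall : ∀ k, p ∣ (f k).map φ := by
        intro k
        by_cases hk : k ∈ s
        · have : (f k).map φ ∈ Ideal.span ({c} : Set (R ⧸ m)[X]) := by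
            rw [← hc]
            exact Ideal.subset_span ⟨k, hk, rfl⟩
          exact hpc.trans (Ideal.mem_span_singleton.1 this)
        · simp only [s, Finset.mem_filter, Finset.mem_univ, true_and, not_and_or, not_not] at hk
          rcases hk with rfl | rfl
          · exact hpi
          · exact hpj
      have := congrArg (Polynomial.map φ) hy
      rw [dotProduct, Polynomial.map_sum, Polynomial.map_one] at this
      rw [← this]
      exact Finset.dvd_sum fun k _ => by
        rw [Polynomial.map_mul]
        exact (hall k).mul_left _
  choose g hg using fun k => Polynomial.map_surjective φ Ideal.Quotient.mk_surjective (t * q k)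
  let w : ι → R[X] := fun k => if k ∈ s then g k else 0
  have hwi : w i = 0 := by simp [w, s]
  have hwj : w j = 0 := by simp [w, s]
  have hF := transvection f (Pi.single j 1) w (by simp [hwj])
  have hw : (w ⬝ᵥ f).map φ = t * c := by
    rw [← hq, dotProduct, Polynomial.map_sum, Finset.mul_sum,
      ← Finset.sum_subset (Finset.subset_univ s) fun k _ hk => by simp [w, hk]]
    exact Finset.sum_congr rfl fun k hk => by simp [w, hk, hg, mul_assoc]
  set F := f + (w ⬝ᵥ f) • (Pi.single j 1 : ι → R[X]) with hFdef
  have hFi : F i = f i := by simp [F, hij]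
  have hFj : F j = f j + w ⬝ᵥ f := by simp [F]
  obtain ⟨r, hr, a, b, hab⟩ := exists_notMem_C_eq hm (p := F i) (q := F j) (hFi ▸ hi) (by
    rw [hFi, hFj, Polynomial.map_add, hw]
    exact ht)
  exact ⟨r, substIdeal_mono hF (mem_substIdeal_of_eq_add F hij hab), hr⟩

/-- A unimodular row of polynomials with a monic entry is equivalent to its value at zero. -/
theorem eval_zero [IsDomain R] [Nontrivial ι] (f : ι → R[X]) {i : ι} (hi : (f i).Monic)
    (hf : ∃ y : ι → R[X], y ⬝ᵥ f = 1) : RowEquiv f (fun k => C ((f k).coeff 0)) := by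
  obtain ⟨j, hij⟩ := exists_ne i
  have htop : substIdeal f = ⊤ := by
    by_contra h
    obtain ⟨m, hm, hle⟩ := Ideal.exists_le_maximal _ h
    obtain ⟨c, hc, hcm⟩ := exists_mem_substIdeal_notMem f hij.symm hi hf hm
    exact hcm (hle hc)
  have h1 : (1 : R) ∈ substIdeal f := htop ▸ trivial
  have := h1 X 0 (by simp)
  simpa [coeff_zero_eq_eval_zero] using this

end RowEquiv

namespace LaurentPolynomial

open Polynomial

variable {R : Type*} [CommRing R]

/-- A Laurent polynomial is bimonic if, up to a unit, it is a monic polynomial whose constant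
coefficient is a unit. -/
def Bimonic (a : R[T;T⁻¹]) : Prop :=
  ∃ (u : R[T;T⁻¹]ˣ) (p : R[X]), p.Monic ∧ IsUnit (p.coeff 0) ∧ u * a = toLaurent p

theorem bimonic_of_isUnit_coeff [Nontrivial R] {a : R[T;T⁻¹]} (ha : a ≠ 0)
    (h : ∀ n, a.coeff n = 0 ∨ IsUnit (a.coeff n)) : Bimonic a := by
  obtain ⟨n, f, hf⟩ := exists_T_pow a
  have hcoeff : ∀ k, f.coeff k = 0 ∨ IsUnit (f.coeff k) := by
    intro k
    have h1 : (toLaurent f).coeff k = a.coeff (k - n) := by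
      rw [hf]
      have := AddMonoidAlgebra.coeff_mul_single_add a (1 : R) (n : ℤ) (k - n : ℤ)
      rwa [sub_add_cancel, mul_one] at this
    have h2 : (toLaurent f).coeff k = f.coeff k :=
      Finsupp.mapDomain_apply Nat.castEmbedding.injective _ _
    rw [← h2, h1]
    exact h _
  have hf0 : f ≠ 0 := by
    rintro rfl
    rw [map_zero] at hf
    exact ha ((isUnit_T n).mul_left_eq_zero.1 hf.symm)
  obtain ⟨q, hq, hq0⟩ := exists_eq_pow_rootMultiplicity_mul_and_not_dvd f hf0 0
  rw [map_zero, sub_zero] at hq hq0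
  set m := f.rootMultiplicity 0
  have hqc : ∀ k, q.coeff k = 0 ∨ IsUnit (q.coeff k) := by
    intro k
    have := hcoeff (k + m)
    rwa [hq, mul_comm, coeff_mul_X_pow] at this
  have hq' : q ≠ 0 := by rintro rfl; simp at hq0
  obtain ⟨c, hc⟩ := (hqc q.natDegree).resolve_left (by simpa using hq')
  rw [X_dvd_iff] at hq0
  refine ⟨(isUnit_T (n - m)).unit * c⁻¹.map (C : R →+* R[T;T⁻¹]),
    Polynomial.C (↑c⁻¹ : R) * q, ?_, ?_, ?_⟩
  · rw [Monic, leadingCoeff_C_mul_of_isUnit c⁻¹.isUnit, leadingCoeff, ← hc, Units.inv_mul]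
  · rw [coeff_C_mul]
    exact c⁻¹.isUnit.mul ((hqc 0).resolve_left hq0)
  · rw [map_mul, toLaurent_C]
    have : toLaurent q = T (n - m) * a := by
      rw [hq, map_mul, toLaurent_X_pow] at hf
      have h3 : (T (-m) : R[T;T⁻¹]) * T m = 1 := by rw [← T_add]; simp
      calc toLaurent q = (T (-m) * T m) * toLaurent q := by rw [h3, one_mul]
        _ = T (-m) * (a * T n) := by rw [← hf]; ring
        _ = T (n - m) * a := by rw [T_sub]; ring
    rw [this]
    simp
    ring

section Quotient

variable {p : R[X]} (hp : IsUnit (p.coeff 0))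
include hp

theorem isUnit_mk_X : IsUnit (Ideal.Quotient.mk (Ideal.span {p}) X) := by
  obtain ⟨c, hc⟩ := hp
  refine IsUnit.of_mul_eq_one (Ideal.Quotient.mk _ (- (Polynomial.C (↑c⁻¹ : R) * p.divX))) ?_
  rw [← map_mul, ← map_one (Ideal.Quotient.mk _), Ideal.Quotient.mk_eq_mk_iff_sub_mem,
    Ideal.mem_span_singleton]
  refine ⟨-Polynomial.C (↑c⁻¹ : R), ?_⟩
  have h1 := p.divX_mul_X_add
  have h2 : (Polynomial.C (p.coeff 0) : R[X]) * Polynomial.C (↑c⁻¹ : R) = 1 := by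
    rw [← hc, ← Polynomial.C_mul]; simp
  linear_combination h2 - (Polynomial.C (↑c⁻¹ : R)) * h1

/-- Reduction of Laurent polynomials modulo a polynomial with invertible constant coefficient. -/
theorem exists_ringHom_quotient : ∃ ψ : R[T;T⁻¹] →+* R[X] ⧸ Ideal.span {p},
    ∀ q, ψ (toLaurent q) = Ideal.Quotient.mk _ q := by
  refine ⟨eval₂ ((Ideal.Quotient.mk _).comp Polynomial.C) (isUnit_mk_X hp).unit, fun q => ?_⟩
  rw [eval₂_toLaurent]
  simpa using (Polynomial.hom_eval₂ q Polynomial.C (Ideal.Quotient.mk (Ideal.span {p})) X).symm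

theorem dvd_of_toLaurent_dvd {q : R[X]} (h : toLaurent p ∣ toLaurent q) : p ∣ q := by
  obtain ⟨ψ, hψ⟩ := exists_ringHom_quotient hp
  obtain ⟨a, ha⟩ := h
  have := congrArg ψ ha
  rw [map_mul, hψ, hψ, Ideal.Quotient.eq_zero_iff_mem.2 (Ideal.mem_span_singleton_self p),
    zero_mul, Ideal.Quotient.eq_zero_iff_mem, Ideal.mem_span_singleton] at this
  exact this

theorem exists_toLaurent_dvd_sub (a : R[T;T⁻¹]) : ∃ q : R[X], toLaurent p ∣ a - toLaurent q := by
  obtain ⟨ψ, hψ⟩ := exists_ringHom_quotient hp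
  obtain ⟨q, hq⟩ := Ideal.Quotient.mk_surjective (ψ a)
  let θ : R[X] ⧸ Ideal.span {p} →+* R[T;T⁻¹] ⧸ Ideal.span {toLaurent p} :=
    Ideal.quotientMap _ toLaurent (by
      rw [Ideal.span_singleton_le_iff_mem, Ideal.mem_comap]
      exact Ideal.mem_span_singleton_self _)
  have hθ : θ.comp ψ = Ideal.Quotient.mk _ := by
    refine IsLocalization.ringHom_ext (Submonoid.powers (X : R[X])) (RingHom.ext fun r => ?_)
    rw [RingHom.comp_apply, RingHom.comp_apply, RingHom.comp_apply, algebraMap_eq_toLaurent, hψ,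
      Ideal.quotientMap_mk]
  refine ⟨q, ?_⟩
  rw [← Ideal.mem_span_singleton, ← Ideal.Quotient.mk_eq_mk_iff_sub_mem, ← hθ, RingHom.comp_apply,
    RingHom.comp_apply, hψ, hq]

end Quotient

theorem Bimonic.exists_equiv_quotient {a : R[T;T⁻¹]} (ha : Bimonic a) :
    ∃ p : R[X], p.Monic ∧
      Nonempty ((R[X] ⧸ Ideal.span {p}) ≃ₗ[R] (R[T;T⁻¹] ⧸ Ideal.span {a})) := by
  obtain ⟨u, p, hp, hp0, hu⟩ := ha
  have hspan : Ideal.span {a} = Ideal.span {toLaurent p} := by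
    rw [← hu, Ideal.span_singleton_mul_left_unit u.isUnit]
  rw [hspan]
  have hle : Ideal.span {p} ≤ (Ideal.span {toLaurent p}).comap toLaurentAlg := by
    rw [Ideal.span_singleton_le_iff_mem, Ideal.mem_comap]
    exact Ideal.mem_span_singleton_self _
  refine ⟨p, hp, ⟨LinearEquiv.ofBijective (Ideal.quotientMapₐ _ toLaurentAlg hle).toLinearMap
    ⟨?_, ?_⟩⟩⟩
  · rw [← LinearMap.ker_eq_bot, LinearMap.ker_eq_bot']
    intro x hx
    obtain ⟨q, rfl⟩ := Ideal.Quotient.mk_surjective x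
    have : Ideal.Quotient.mk (Ideal.span {toLaurent p}) (toLaurent q) = 0 := hx
    rw [Ideal.Quotient.eq_zero_iff_mem, Ideal.mem_span_singleton] at this ⊢
    exact dvd_of_toLaurent_dvd hp0 this
  · intro x
    obtain ⟨b, rfl⟩ := Ideal.Quotient.mk_surjective x
    obtain ⟨q, hq⟩ := exists_toLaurent_dvd_sub hp0 b
    refine ⟨Ideal.Quotient.mk _ q, ?_⟩
    change Ideal.Quotient.mk (Ideal.span {toLaurent p}) (toLaurent q) = _
    rw [eq_comm, Ideal.Quotient.mk_eq_mk_iff_sub_mem, Ideal.mem_span_singleton]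
    exact hq

open Matrix in
/-- A unimodular row of Laurent polynomials with a bimonic entry is equivalent to a standard basis
vector. -/
theorem Bimonic.rowEquiv_single [IsDomain R] {ι : Type*} [Fintype ι] [DecidableEq ι]
    (v : ι → R[T;T⁻¹]) {i : ι} (hi : Bimonic (v i)) (hv : ∃ y : ι → R[T;T⁻¹], y ⬝ᵥ v = 1) :
    RowEquiv v (Pi.single i 1) := by
  rcases subsingleton_or_nontrivial ι with hι | hι
  · obtain ⟨y, hy⟩ := hv
    refine RowEquiv.single_of_isUnit v i ?_
    have : y i * v i = 1 := by
      rw [← hy, dotProduct, Fintype.sum_subsingleton _ i]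
    exact IsUnit.of_mul_eq_one_right _ this
  obtain ⟨u, p, hp, hp0, hu⟩ := hi
  have h1 := RowEquiv.of_diagonal (Function.update 1 i u) v
  set v1 : ι → R[T;T⁻¹] := fun k => ((Function.update 1 i u : ι → R[T;T⁻¹]ˣ) k : R[T;T⁻¹]) * v k
  have hv1 : v1 i = toLaurent p := by simp [v1, hu]
  choose q hq using fun k => exists_toLaurent_dvd_sub hp0 (v1 k)
  choose r hr using hq
  let P : ι → R[X] := Function.update q i p
  have h2 := RowEquiv.transvection v1 (Function.update (-r) i 0) (Pi.single i 1) (by simp)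
  have h3 : v1 + ((Pi.single i 1 : ι → R[T;T⁻¹]) ⬝ᵥ v1) • Function.update (-r) i 0 =
      fun k => toLaurent (P k) := by
    ext1 k
    by_cases hk : k = i
    · subst hk
      simp [P, hv1]
    · simp [P, hv1, hk]
      linear_combination hr k
  rw [h3] at h2
  have h4 := h1.trans h2
  have hPi : P i = p := by simp [P]
  have hP : ∃ y : ι → R[X], y ⬝ᵥ P = 1 := by
    obtain ⟨y, hy⟩ := h4.unimodular hv
    obtain ⟨ψ, hψ⟩ := exists_ringHom_quotient hp0
    choose z hz using fun k => Ideal.Quotient.mk_surjective (ψ (y k))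
    have h5 := congrArg ψ hy
    simp only [dotProduct, map_sum, map_mul, hψ, ← hz] at h5
    simp only [← map_mul, ← map_sum] at h5
    rw [map_one, ← map_one (Ideal.Quotient.mk _), Ideal.Quotient.mk_eq_mk_iff_sub_mem,
      Ideal.mem_span_singleton] at h5
    obtain ⟨s, hs⟩ := h5
    refine ⟨z - Pi.single i s, ?_⟩
    rw [sub_dotProduct, single_dotProduct, hPi, dotProduct]
    linear_combination hs
  have h5 := RowEquiv.eval_zero P (hPi ▸ hp) hP
  have h6 := h5.trans (RowEquiv.single_of_isUnit _ i (by
    rw [hPi]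
    exact hp0.map Polynomial.C))
  have h7 := h6.map toLaurent
  refine h4.trans ?_
  convert h7 using 1
  ext1 k
  by_cases hk : k = i
  · subst hk; simp
  · simp [hk]

end LaurentPolynomial

section

open Function

/-- Schanuel's lemma. -/
theorem LinearMap.nonempty_prod_equiv_of_exact {A P P' K K' Q : Type*} [CommRing A]
    [AddCommGroup P] [AddCommGroup P'] [AddCommGroup K] [AddCommGroup K'] [AddCommGroup Q]
    [Module A P] [Module A P'] [Module A K] [Module A K'] [Module A Q]
    [Module.Projective A P] [Module.Projective A P']
    {i : K →ₗ[A] P} {f : P →ₗ[A] Q} {i' : K' →ₗ[A] P'} {f' : P' →ₗ[A] Q}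
    (hi : Injective i) (hif : Exact i f) (hf : Surjective f)
    (hi' : Injective i') (hif' : Exact i' f') (hf' : Surjective f') :
    Nonempty ((K' × P) ≃ₗ[A] (K × P')) := by
  let X : Submodule A (P × P') :=
    LinearMap.eqLocus (f ∘ₗ LinearMap.fst A P P') (f' ∘ₗ LinearMap.snd A P P')
  have hX : ∀ x : X, f x.1.1 = f' x.1.2 := fun x => x.2
  let p : X →ₗ[A] P := LinearMap.fst A P P' ∘ₗ X.subtype
  let p' : X →ₗ[A] P' := LinearMap.snd A P P' ∘ₗ X.subtype
  let j : K →ₗ[A] X := (LinearMap.inl A P P' ∘ₗ i).codRestrict X fun k => by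
    simp [X, hif.apply_apply_eq_zero]
  let j' : K' →ₗ[A] X := (LinearMap.inr A P P' ∘ₗ i').codRestrict X fun k => by
    simp [X, hif'.apply_apply_eq_zero]
  have hp : Surjective p := fun x => by
    obtain ⟨y, hy⟩ := hf' (f x)
    exact ⟨⟨(x, y), hy.symm⟩, rfl⟩
  have hp' : Surjective p' := fun x => by
    obtain ⟨y, hy⟩ := hf (f' x)
    exact ⟨⟨(y, x), hy⟩, rfl⟩
  have hj : Injective j := fun a b h => hi (congrArg (fun x : X => x.1.1) h)
  have hj' : Injective j' := fun a b h => hi' (congrArg (fun x : X => x.1.2) h)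
  have hjp : Exact j p' := by
    rintro ⟨⟨x, y⟩, hxy⟩
    constructor
    · intro h
      have hy : y = 0 := h
      subst hy
      obtain ⟨k, hk⟩ := (hif x).1 ((hX ⟨(x, 0), hxy⟩).trans (map_zero f'))
      exact ⟨k, Subtype.ext (Prod.ext hk rfl)⟩
    · rintro ⟨k, hk⟩
      exact congrArg (fun z : X => z.1.2) hk.symm
  have hjp' : Exact j' p := by
    rintro ⟨⟨x, y⟩, hxy⟩
    constructor
    · intro h
      have hx : x = 0 := h
      subst hx
      obtain ⟨k, hk⟩ := (hif' y).1 ((hX ⟨(0, y), hxy⟩).symm.trans (map_zero f))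
      exact ⟨k, Subtype.ext (Prod.ext rfl hk)⟩
    · rintro ⟨k, hk⟩
      exact congrArg (fun z : X => z.1.1) hk.symm
  obtain ⟨s, hs⟩ := Module.projective_lifting_property p LinearMap.id hp
  obtain ⟨s', hs'⟩ := Module.projective_lifting_property p' LinearMap.id hp'
  exact ⟨(hjp'.splitSurjectiveEquiv hj' ⟨s, hs⟩).1.symm.trans
    (hjp.splitSurjectiveEquiv hj ⟨s', hs'⟩).1⟩

section Cancellation

open Matrix

variable {A : Type*} [CommRing A] [IsDomain A]

/-- Every unimodular row can be moved to a standard basis vector. -/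
def UnimodularRowsTrivial (A : Type*) [CommRing A] : Prop :=
  ∀ (s : ℕ) (v : Fin s → A), (∃ y : Fin s → A, y ⬝ᵥ v = 1) → ∃ i, RowEquiv v (Pi.single i 1)

theorem UnimodularRowsTrivial.free_of_prod (hA : UnimodularRowsTrivial A) (P : Type*)
    [AddCommGroup P] [Module A P] [Module.Finite A P] [Module.Free A (P × A)] :
    Module.Free A P := by
  let φ : (P × A) ≃ₗ[A] (Fin (Module.finrank A (P × A)) → A) :=
    (Module.finBasis A (P × A)).equivFun
  set s := Module.finrank A (P × A)
  have huni : ∃ y : Fin s → A, y ⬝ᵥ φ (0, 1) = 1 := by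
    let l : (Fin s → A) →ₗ[A] A := LinearMap.snd A P A ∘ₗ φ.symm.toLinearMap
    refine ⟨fun k => l (fun j => if k = j then 1 else 0), ?_⟩
    have : l (φ (0, 1)) = 1 := by simp [l]
    refine Eq.trans ?_ this
    rw [LinearMap.pi_apply_eq_sum_univ l]
    simp [dotProduct, mul_comm]
  obtain ⟨i, M, hM, hMv⟩ := hA s _ huni
  let ψ : (P × A) ≃ₗ[A] (Fin s → A) :=
    φ.trans (Matrix.toLinearEquiv' M (Matrix.invertibleOfIsUnitDet M hM))
  have hψ : ψ (0, 1) = Pi.single i 1 := hMv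
  have hψa (a : A) : ψ (0, a) = Pi.single i a := by
    have := congrArg (a • ·) hψ
    simpa [← map_smul, ← Pi.single_smul] using this
  let η : P →ₗ[A] ({k // k ≠ i} → A) :=
    LinearMap.funLeft A A Subtype.val ∘ₗ ψ.toLinearMap ∘ₗ LinearMap.inl A P A
  have hη (p : P) (k : {k // k ≠ i}) : η p k = ψ (p, 0) k := rfl
  refine Module.Free.of_equiv (LinearEquiv.ofBijective η ⟨?_, ?_⟩).symm
  · rw [← LinearMap.ker_eq_bot, LinearMap.ker_eq_bot']
    intro p hp
    have : ψ (p, 0) = ψ (0, ψ (p, 0) i) := by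
      rw [hψa]
      ext k
      by_cases hk : k = i
      · subst hk; simp
      · rw [← hη p ⟨k, hk⟩, hp]
        simp [hk]
    exact congrArg Prod.fst (ψ.injective this)
  · intro w
    let w' : Fin s → A := fun k => if h : k ≠ i then w ⟨k, h⟩ else 0
    obtain ⟨⟨p, a⟩, hpa⟩ := ψ.surjective w'
    refine ⟨p, funext fun k => ?_⟩
    have h1 : ψ (p, 0) = w' - Pi.single i a := by
      rw [← hψa, ← hpa, ← map_sub]
      simp
    rw [hη, h1]
    simp [w', k.2]

theorem UnimodularRowsTrivial.free_of_prod_pi (hA : UnimodularRowsTrivial A) (m : ℕ) :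
    ∀ (P : Type*) [AddCommGroup P] [Module A P] [Module.Finite A P]
      [Module.Free A (P × (Fin m → A))], Module.Free A P := by
  induction m with
  | zero =>
    intro P _ _ _ _
    exact Module.Free.of_equiv (LinearEquiv.prodUnique : (P × (Fin 0 → A)) ≃ₗ[A] P)
  | succ m ih =>
    intro P _ _ _ _
    have e : (P × (Fin (m + 1) → A)) ≃ₗ[A] ((P × (Fin m → A)) × A) :=
      ((LinearEquiv.refl A P).prodCongr ((Fin.consLinearEquiv A fun _ => A).symm.trans
        (LinearEquiv.prodComm A _ _))).trans (LinearEquiv.prodAssoc A _ _ _).symm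
    have := Module.Free.of_equiv e
    have := hA.free_of_prod (P × (Fin m → A))
    exact ih P

end Cancellation

end

namespace LaurentPolynomial

open Function

variable {R : Type*} [CommRing R] [IsDomain R]

section Presentation

variable {Q : Type*} [AddCommGroup Q] [Module R Q] [Module R[T;T⁻¹] Q]
  [IsScalarTower R R[T;T⁻¹] Q] {m : Type*} [Fintype m] [DecidableEq m]

omit [IsDomain R] in
theorem exists_eq_mulVec_add {Φ Φ' : Matrix m m R} (h : Φ * Φ' = 1)
    {N : Matrix m m R[T;T⁻¹]}
    (hN : ∀ y : m → R[T;T⁻¹], N.mulVec y = (T 1 : R[T;T⁻¹]) • y - (Φ.map C).mulVec y)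
    (y : m → R[T;T⁻¹]) : ∃ (z : m → R[T;T⁻¹]) (c : m → R), y = N.mulVec z + C ∘ c := by
  have hC (Ψ : Matrix m m R) (c : m → R) : (Ψ.map C).mulVec (C ∘ c) = C ∘ Ψ.mulVec c :=
    (funext (RingHom.map_mulVec C Ψ c)).symm
  have hNC (c : m → R) : N.mulVec (C ∘ c) = (T 1 : R[T;T⁻¹]) • (C ∘ c) - C ∘ Φ.mulVec c := by
    rw [hN, hC]
  have hT (k : ℤ) (c : m → R) : ∃ (z : m → R[T;T⁻¹]) (c' : m → R),
      (T k : R[T;T⁻¹]) • (C ∘ c) = N.mulVec z + C ∘ c' := by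
    induction k with
    | zero => exact ⟨0, c, by simp⟩
    | succ k ih =>
      obtain ⟨z, c', hz⟩ := ih
      refine ⟨(T 1 : R[T;T⁻¹]) • z + C ∘ c', Φ.mulVec c', ?_⟩
      rw [add_comm (k : ℤ) 1, T_add, mul_smul, hz, smul_add, Matrix.mulVec_add, hNC,
        Matrix.mulVec_smul]
      abel
    | pred k ih =>
      obtain ⟨z, c', hz⟩ := ih
      refine ⟨(T (-1) : R[T;T⁻¹]) • z - (T (-1) : R[T;T⁻¹]) • (C ∘ Φ'.mulVec c'), Φ'.mulVec c', ?_⟩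
      have h1 : (T (-1) : R[T;T⁻¹]) * T 1 = 1 := by rw [← T_add]; simp
      rw [sub_eq_add_neg, add_comm _ (-1 : ℤ), T_add, mul_smul, hz, smul_add, Matrix.mulVec_sub,
        Matrix.mulVec_smul, Matrix.mulVec_smul, hNC, Matrix.mulVec_mulVec, h, Matrix.one_mulVec,
        smul_sub, smul_smul, h1, one_smul]
      abel
  have hadd {y y' : m → R[T;T⁻¹]}
      (hy : ∃ (z : m → R[T;T⁻¹]) (c : m → R), y = N.mulVec z + C ∘ c)
      (hy' : ∃ (z : m → R[T;T⁻¹]) (c : m → R), y' = N.mulVec z + C ∘ c) :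
      ∃ (z : m → R[T;T⁻¹]) (c : m → R), y + y' = N.mulVec z + C ∘ c := by
    obtain ⟨z, c, rfl⟩ := hy
    obtain ⟨z', c', rfl⟩ := hy'
    refine ⟨z + z', c + c', ?_⟩
    have : (C ∘ (c + c') : m → R[T;T⁻¹]) = C ∘ c + C ∘ c' := by ext1; simp
    rw [this, Matrix.mulVec_add]
    abel
  refine Pi.single_induction
    (fun y => ∃ (z : m → R[T;T⁻¹]) (c : m → R), y = N.mulVec z + C ∘ c) y ?_
    (fun _ _ => hadd) fun j a => ?_
  · exact ⟨0, 0, by ext1; simp⟩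
  · induction a using LaurentPolynomial.induction_on' with
    | add p q hp hq => rw [Pi.single_add]; exact hadd hp hq
    | C_mul_T n a =>
      have : (Pi.single j (C a * T n) : m → R[T;T⁻¹]) = (T n : R[T;T⁻¹]) • (C ∘ Pi.single j a) := by
        ext1 k
        rcases eq_or_ne k j with rfl | hk
        · simp only [Pi.single_eq_same, Pi.smul_apply, comp_apply, smul_eq_mul, mul_comm]
        · simp [hk]
      rw [this]
      exact hT n _

/-- A module over the Laurent polynomials which is finite free over the coefficients has a finite
free resolution of length one. -/
theorem exists_exact_of_basis (b : Module.Basis m R Q) :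
    ∃ (i : (m → R[T;T⁻¹]) →ₗ[R[T;T⁻¹]] (m → R[T;T⁻¹])) (f : (m → R[T;T⁻¹]) →ₗ[R[T;T⁻¹]] Q),
      Injective i ∧ Exact i f ∧ Surjective f := by
  let τ (k : ℤ) : Module.End R Q := Algebra.lsmul R R Q (T k : R[T;T⁻¹])
  have hτ : τ 1 * τ (-1) = 1 := by
    rw [← map_mul, ← T_add]
    simp
  let Φ (k : ℤ) : Matrix m m R := LinearMap.toMatrix b b (τ k)
  have hΦ : Φ 1 * Φ (-1) = 1 := by
    rw [← LinearMap.toMatrix_mul, hτ, LinearMap.toMatrix_one]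
  let N : Matrix m m R[T;T⁻¹] := (Φ 1).charmatrix.map Polynomial.toLaurent
  have hN (y : m → R[T;T⁻¹]) : N.mulVec y = (T 1 : R[T;T⁻¹]) • y - ((Φ 1).map C).mulVec y := by
    have : N = (T 1 : R[T;T⁻¹]) • (1 : Matrix m m R[T;T⁻¹]) - (Φ 1).map C := by
      ext1 i j
      rcases eq_or_ne i j with rfl | hij
      · simp [N]
      · simp [N, hij]
    rw [this, Matrix.sub_mulVec, Matrix.smul_mulVec, Matrix.one_mulVec]
  let f : (m → R[T;T⁻¹]) →ₗ[R[T;T⁻¹]] Q := Fintype.linearCombination R[T;T⁻¹] b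
  have hCs (a : R) (q : Q) : (C a : R[T;T⁻¹]) • q = a • q := by
    rw [C_eq_algebraMap, algebraMap_smul]
  have hfC (c : m → R) : f (C ∘ c) = b.equivFun.symm c := by
    simp [f, Fintype.linearCombination_apply, Module.Basis.equivFun_symm_apply, hCs]
  have hfN (y : m → R[T;T⁻¹]) : f (N.mulVec y) = 0 := by
    have : f ∘ₗ N.mulVecLin = 0 := by
      refine (Pi.basisFun R[T;T⁻¹] m).ext fun j => ?_
      have h1 : (Pi.basisFun R[T;T⁻¹] m j) = C ∘ Pi.single j (1 : R) := by
        ext1 k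
        rcases eq_or_ne k j with rfl | hk
        · simp
        · simp [hk]
      have h2 : ((Φ 1).map C).mulVec (C ∘ Pi.single j (1 : R)) =
          C ∘ (Φ 1).mulVec (Pi.single j 1) :=
        (funext (RingHom.map_mulVec C (Φ 1) _)).symm
      rw [LinearMap.comp_apply, Matrix.mulVecLin_apply, hN, map_sub, map_smul, h1, h2, hfC, hfC]
      have h3 : (Φ 1).mulVec (Pi.single j 1) = b.equivFun (τ 1 (b j)) := by
        ext1 k
        simp [Φ, LinearMap.toMatrix_apply]
      rw [h3, LinearEquiv.symm_apply_apply]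
      simp [τ, Module.Basis.equivFun_symm_apply, Pi.single_apply]
    exact LinearMap.congr_fun this y
  refine ⟨N.mulVecLin, f, ?_, ?_, ?_⟩
  · rw [← LinearMap.ker_eq_bot, LinearMap.ker_eq_bot']
    intro y hy
    refine Matrix.eq_zero_of_mulVec_eq_zero ?_ hy
    have : N.det = Polynomial.toLaurent (Φ 1).charpoly := (RingHom.map_det _ _).symm
    rw [this, Ne, Polynomial.toLaurent_eq_zero]
    exact (Matrix.charpoly_monic _).ne_zero
  · intro y
    constructor
    · intro hy
      obtain ⟨z, c, rfl⟩ := exists_eq_mulVec_add hΦ hN y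
      rw [map_add, hfN, zero_add, hfC, LinearEquiv.map_eq_zero_iff] at hy
      exact ⟨z, by ext1; simp [hy]⟩
    · rintro ⟨z, rfl⟩
      exact hfN z
  · intro q
    exact ⟨C ∘ b.equivFun q, by rw [hfC, LinearEquiv.symm_apply_apply]⟩

end Presentation
end LaurentPolynomial

section

open Function

theorem Module.Projective.of_projective_of_free (R A P : Type*) [CommRing R] [CommRing A]
    [Algebra R A] [Module.Free R A] [AddCommGroup P] [Module R P] [Module A P]
    [IsScalarTower R A P] [Module.Projective A P] : Module.Projective R P := by
  obtain ⟨s, hs⟩ := Module.projective_def'.1 (inferInstance : Module.Projective A P)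
  exact Module.Projective.of_split (s.restrictScalars R)
    ((Finsupp.linearCombination A id).restrictScalars R)
    (LinearMap.ext fun x => LinearMap.congr_fun hs x)

theorem Submodule.projective_quotient_of_projection {R P : Type*} [Ring R] [AddCommGroup P]
    [Module R P] [Module.Projective R P] (D : Submodule R P) (r : P →ₗ[R] P)
    (hr : ∀ x, r x ∈ D) (hrD : ∀ x ∈ D, r x = x) : Module.Projective R (P ⧸ D) := by
  refine Module.Projective.of_split
    (D.liftQ (LinearMap.id - r) fun x hx => by simp [hrD x hx]) D.mkQ ?_
  ext x
  simp [sub_eq_self, hr x]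

/-- A finite module over a domain contains a finite free submodule with torsion quotient. -/
theorem Module.exists_injective_pi_smul_mem_range (A P : Type*) [CommRing A] [IsDomain A]
    [AddCommGroup P] [Module A P] [Module.Finite A P] :
    ∃ (d : ℕ) (i : (Fin d → A) →ₗ[A] P) (g : A), Function.Injective i ∧ g ≠ 0 ∧
      ∀ x : P, g • x ∈ LinearMap.range i := by
  obtain ⟨k, s, hs⟩ := Module.Finite.exists_fin (R := A) (M := P)
  obtain ⟨I, hI, hI'⟩ := exists_maximal_linearIndepOn A s
  have hall (j : Fin k) : ∃ a : A, a ≠ 0 ∧ a • s j ∈ Submodule.span A (s '' I) := by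
    by_cases hj : j ∈ I
    · exact ⟨1, one_ne_zero, Submodule.smul_mem _ _
        (Submodule.subset_span (Set.mem_image_of_mem s hj))⟩
    · exact hI' j hj
  choose a ha0 ha using hall
  let e : I ≃ Fin (Nat.card I) := Finite.equivFin I
  let v : Fin (Nat.card I) → P := fun j => s (e.symm j)
  have hv : LinearIndependent A v := LinearIndependent.comp hI e.symm e.symm.injective
  have hrange : LinearMap.range (Fintype.linearCombination A v) = Submodule.span A (s '' I) := by
    rw [Fintype.range_linearCombination]
    congr 1
    ext x
    constructor
    · rintro ⟨j, rfl⟩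
      exact Set.mem_image_of_mem s (e.symm j).2
    · rintro ⟨j, hj, rfl⟩
      exact ⟨e ⟨j, hj⟩, congrArg (fun k : I => s k) (e.symm_apply_apply ⟨j, hj⟩)⟩
  refine ⟨Nat.card I, Fintype.linearCombination A v, ∏ j, a j, ?_,
    Finset.prod_ne_zero_iff.2 fun j _ => ha0 j, fun x => ?_⟩
  · exact linearIndependent_iff_injective_fintypeLinearCombination.1 hv
  · rw [hrange]
    have hx : x ∈ Submodule.span A (Set.range s) := hs ▸ Submodule.mem_top
    induction hx using Submodule.span_induction with
    | mem x hx =>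
      obtain ⟨j, rfl⟩ := hx
      rw [← Finset.prod_erase_mul _ _ (Finset.mem_univ j), mul_smul]
      exact Submodule.smul_mem _ _ (ha j)
    | zero => simp
    | add x y _ _ hx hy => rw [smul_add]; exact add_mem hx hy
    | smul b x _ hx => rw [smul_comm]; exact Submodule.smul_mem _ _ hx

namespace LaurentPolynomial

variable {R : Type*} [CommRing R] [IsDomain R]

omit [IsDomain R] in
theorem Bimonic.free_quotient {a : R[T;T⁻¹]} (ha : Bimonic a) :
    Module.Free R (R[T;T⁻¹] ⧸ Ideal.span {a}) := by
  obtain ⟨p, hp, ⟨e⟩⟩ := ha.exists_equiv_quotient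
  have := hp.free_quotient
  exact Module.Free.of_equiv e

omit [IsDomain R] in
theorem Bimonic.finite_quotient {a : R[T;T⁻¹]} (ha : Bimonic a) :
    Module.Finite R (R[T;T⁻¹] ⧸ Ideal.span {a}) := by
  obtain ⟨p, hp, ⟨e⟩⟩ := ha.exists_equiv_quotient
  have := hp.finite_quotient
  exact Module.Finite.equiv e

theorem Bimonic.exists_leftInverse_mul {a : R[T;T⁻¹]} (ha : Bimonic a) (ha0 : a ≠ 0) :
    ∃ ρ : R[T;T⁻¹] →ₗ[R] R[T;T⁻¹], ∀ x, ρ (a * x) = x := by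
  have := ha.free_quotient
  let q : R[T;T⁻¹] →ₗ[R] R[T;T⁻¹] ⧸ Ideal.span {a} :=
    (Ideal.Quotient.mkₐ R (Ideal.span {a})).toLinearMap
  have hq : Surjective q := Ideal.Quotient.mk_surjective
  have hinj : Injective (LinearMap.mulLeft R a) := mul_right_injective₀ ha0
  have hex : Exact (LinearMap.mulLeft R a) q := fun x =>
    Ideal.Quotient.eq_zero_iff_mem.trans (Ideal.mem_span_singleton.trans
      ⟨fun ⟨y, hy⟩ => ⟨y, hy.symm⟩, fun ⟨y, hy⟩ => ⟨y, hy.symm⟩⟩)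
  obtain ⟨l, hl⟩ := Module.projective_lifting_property q LinearMap.id hq
  have hsplit : Injective (LinearMap.mulLeft R a) ∧ ∃ l, q ∘ₗ l = LinearMap.id := ⟨hinj, l, hl⟩
  obtain ⟨-, ρ, hρ⟩ := (hex.split_tfae'.out 0 1).1 hsplit
  exact ⟨ρ, LinearMap.congr_fun hρ⟩

variable {P : Type*} [AddCommGroup P] [Module R P] [Module R[T;T⁻¹] P]
  [IsScalarTower R R[T;T⁻¹] P]

theorem Bimonic.projective_quotient_range {ι : Type*} [Module.Projective R[T;T⁻¹] P]
    {i : (ι → R[T;T⁻¹]) →ₗ[R[T;T⁻¹]] P} (hi : Injective i) {g : R[T;T⁻¹]} (hg : Bimonic g)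
    (hg0 : g ≠ 0) (hgi : ∀ x : P, g • x ∈ LinearMap.range i) :
    Module.Projective R (P ⧸ LinearMap.range i) := by
  have := Module.Projective.of_projective_of_free R R[T;T⁻¹] P
  obtain ⟨ρ, hρ⟩ := hg.exists_leftInverse_mul hg0
  let j : P →ₗ[R[T;T⁻¹]] (ι → R[T;T⁻¹]) := (LinearEquiv.ofInjective i hi).symm.toLinearMap ∘ₗ
    (LinearMap.lsmul R[T;T⁻¹] P g).codRestrict (LinearMap.range i) hgi
  have hij (x : P) : i (j x) = g • x :=
    congrArg Subtype.val ((LinearEquiv.ofInjective i hi).apply_symm_apply ⟨g • x, hgi x⟩)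
  have hji (x : ι → R[T;T⁻¹]) : j (i x) = g • x := hi (by rw [hij, map_smul])
  clear_value j
  have := Submodule.projective_quotient_of_projection ((LinearMap.range i).restrictScalars R)
    (i.restrictScalars R ∘ₗ ρ.compLeft ι ∘ₗ j.restrictScalars R)
    (fun x => ⟨ρ.compLeft ι (j x), rfl⟩) (by
      rintro _ ⟨x, rfl⟩
      refine congrArg i (funext fun k => ?_)
      refine (congrArg (fun y : ι → R[T;T⁻¹] => ρ (y k)) (hji x)).trans (hρ (x k)))
  exact Module.Projective.of_equiv (Submodule.Quotient.restrictScalarsEquiv R (LinearMap.range i))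

omit [IsDomain R] in
theorem Bimonic.finite_quotient_of_smul_mem [Module.Finite R[T;T⁻¹] P]
    {D : Submodule R[T;T⁻¹] P} {g : R[T;T⁻¹]} (hg : Bimonic g)
    (hgD : ∀ x : P, g • x ∈ D) : Module.Finite R (P ⧸ D) := by
  have htor : Module.IsTorsionBySet R[T;T⁻¹] (P ⧸ D) (Ideal.span {g}) := by
    rw [Ideal.span, Module.isTorsionBySet_span_singleton_iff]
    intro x
    obtain ⟨x, rfl⟩ := Submodule.Quotient.mk_surjective _ x
    exact (Submodule.Quotient.mk_eq_zero _).2 (hgD x)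
  let := htor.module
  have : IsScalarTower R (R[T;T⁻¹] ⧸ Ideal.span {g}) (P ⧸ D) := htor.isScalarTower
  have : IsScalarTower R[T;T⁻¹] (R[T;T⁻¹] ⧸ Ideal.span {g}) (P ⧸ D) := htor.isScalarTower
  have := hg.finite_quotient
  have := Module.Finite.of_restrictScalars_finite R[T;T⁻¹] (R[T;T⁻¹] ⧸ Ideal.span {g}) (P ⧸ D)
  exact Module.Finite.trans (R[T;T⁻¹] ⧸ Ideal.span {g}) (P ⧸ D)

/-- A finite projective module over the Laurent polynomials with a free submodule of bimonic
torsion quotient is free, provided unimodular rows over the Laurent polynomials are trivial and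
finite projective modules over the coefficients are free. -/
theorem Bimonic.free_of_projective.{u} {P : Type u} [AddCommGroup P] [Module R[T;T⁻¹] P]
    [Module.Projective R[T;T⁻¹] P] [Module.Finite R[T;T⁻¹] P]
    (hA : UnimodularRowsTrivial R[T;T⁻¹])
    (hR : ∀ (Q : Type u) [AddCommGroup Q] [Module R Q] [Module.Projective R Q] [Module.Finite R Q],
      Module.Free R Q)
    {d : ℕ} {i : (Fin d → R[T;T⁻¹]) →ₗ[R[T;T⁻¹]] P} (hi : Injective i)
    {g : R[T;T⁻¹]} (hg : Bimonic g) (hg0 : g ≠ 0) (hgi : ∀ x : P, g • x ∈ LinearMap.range i) :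
    Module.Free R[T;T⁻¹] P := by
  let := Module.compHom P (algebraMap R R[T;T⁻¹])
  have : IsScalarTower R R[T;T⁻¹] P := IsScalarTower.of_algebraMap_smul fun _ _ => rfl
  have := hg.projective_quotient_range hi hg0 hgi
  have := hg.finite_quotient_of_smul_mem hgi
  have := hR (P ⧸ LinearMap.range i)
  obtain ⟨N, f, hN, hNf, hf⟩ := exists_exact_of_basis (Module.finBasis R (P ⧸ LinearMap.range i))
  have hex : Exact i (LinearMap.range i).mkQ := LinearMap.exact_iff.2 (by simp)
  obtain ⟨e⟩ := LinearMap.nonempty_prod_equiv_of_exact hi hex (Submodule.mkQ_surjective _) hN hNf hf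
  have := Module.Free.of_equiv (e.symm.trans (LinearEquiv.prodComm R[T;T⁻¹] _ _))
  exact hA.free_of_prod_pi (Module.finrank R (P ⧸ LinearMap.range i)) P

end LaurentPolynomial

end

section

open AddMonoidAlgebra LaurentPolynomial Function

theorem exists_int_injOn_sum_mul_pow {n : ℕ} (s : Finset (Fin n → ℤ)) :
    ∃ N : ℤ, Set.InjOn (fun a : Fin n → ℤ => ∑ i, a i * N ^ (i : ℕ)) s := by
  classical
  let p (a : Fin n → ℤ) : Polynomial ℤ := ∑ i, Polynomial.C (a i) * Polynomial.X ^ (i : ℕ)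
  have hp (a : Fin n → ℤ) (ha : a ≠ 0) : p a ≠ 0 := by
    contrapose! ha
    ext j
    have := congrArg (fun q => Polynomial.coeff q j) ha
    simpa [p, Polynomial.finsetSum_coeff, Polynomial.coeff_X_pow, Fin.val_inj] using this
  have hprod : ∏ x ∈ s.offDiag, p (x.1 - x.2) ≠ 0 :=
    Finset.prod_ne_zero_iff.2 fun x hx => hp _ (sub_ne_zero.2 (Finset.mem_offDiag.1 hx).2.2)
  obtain ⟨N, hN⟩ : ∃ N : ℤ, (∏ x ∈ s.offDiag, p (x.1 - x.2)).eval N ≠ 0 := by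
    by_contra! h
    exact hprod (Polynomial.funext fun N => by rw [h, Polynomial.eval_zero])
  refine ⟨N, fun a ha b hb hab => ?_⟩
  by_contra hne
  rw [Polynomial.eval_prod, Finset.prod_ne_zero_iff] at hN
  refine hN (a, b) (Finset.mem_offDiag.2 ⟨ha, hb, hne⟩) ?_
  simp only [p, Polynomial.eval_finsetSum, Polynomial.eval_mul, Polynomial.eval_C,
    Polynomial.eval_pow, Polynomial.eval_X, Pi.sub_apply, sub_mul, Finset.sum_sub_distrib]
  exact sub_eq_zero.2 hab

/-- The change of coordinates of `ℤ ^ (n + 1)` replacing the first coordinate by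
`∑ i, a i * N ^ i`. -/
def addEquivSumMulPow (n : ℕ) (N : ℤ) : (Fin (n + 1) → ℤ) ≃+ ℤ × (Fin n → ℤ) where
  toFun a := (∑ i, a i * N ^ (i : ℕ), Fin.tail a)
  invFun x := Fin.cons (x.1 - ∑ i, x.2 i * N ^ ((i : ℕ) + 1)) x.2
  left_inv a := by
    simp only [Fin.sum_univ_succ, Fin.tail]
    refine Eq.trans ?_ (Fin.cons_self_tail a)
    simp [Fin.tail_def]
  right_inv x := by
    refine Prod.ext ?_ rfl
    simp [Fin.sum_univ_succ]
  map_add' a b := by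
    refine Prod.ext ?_ rfl
    simp [add_mul, Finset.sum_add_distrib]

theorem AddMonoidAlgebra.eq_zero_or_isUnit_of_support_subsingleton {k M : Type*} [Field k]
    [AddCommGroup M] {f : k[M]} (hf : ∀ a b, f.coeff a ≠ 0 → f.coeff b ≠ 0 → a = b) :
    f = 0 ∨ IsUnit f := by
  rcases eq_or_ne f 0 with h | h
  · exact Or.inl h
  · obtain ⟨a, ha⟩ : ∃ a, f.coeff a ≠ 0 := by
      by_contra! h0
      exact h (coeff_inj.1 (Finsupp.ext h0))
    have : f = single a (f.coeff a) := by
      refine coeff_inj.1 (Finsupp.ext fun b => ?_)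
      rw [coeff_single]
      rcases eq_or_ne a b with rfl | hab
      · simp
      · rw [Finsupp.single_eq_of_ne' hab]
        by_contra hb
        exact hab (hf a b ha hb)
    refine Or.inr (IsUnit.of_mul_eq_one (single (-a) (f.coeff a)⁻¹) ?_)
    rw [this, single_mul_single, coeff_single, Finsupp.single_eq_same, mul_inv_cancel₀ ha,
      add_neg_cancel, one_def]

/-- After a change of coordinates, a nonzero Laurent polynomial in several variables becomes
bimonic in the first variable. -/
theorem exists_ringEquiv_bimonic {k : Type*} [Field k] {n : ℕ} {f : k[Fin (n + 1) → ℤ]}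
    (hf : f ≠ 0) : ∃ e : k[Fin (n + 1) → ℤ] ≃+* (k[Fin n → ℤ])[T;T⁻¹], Bimonic (e f) := by
  obtain ⟨N, hN⟩ := exists_int_injOn_sum_mul_pow f.coeff.support
  let σ := addEquivSumMulPow n N
  let e : k[Fin (n + 1) → ℤ] ≃+* (k[Fin n → ℤ])[T;T⁻¹] :=
    (domCongr k k σ).toRingEquiv.trans curryRingEquiv
  have he (z : ℤ) (b : Fin n → ℤ) : ((e f).coeff z).coeff b = f.coeff (σ.symm (z, b)) :=
    coeff_domCongr (R := k) σ f (z, b)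
  refine ⟨e, bimonic_of_isUnit_coeff (by simpa using hf) fun z =>
    eq_zero_or_isUnit_of_support_subsingleton fun a b ha hb => ?_⟩
  rw [he] at ha hb
  have hfst (c : Fin n → ℤ) :
      ∑ i, (σ.symm (z, c)) i * N ^ (i : ℕ) = z :=
    congrArg Prod.fst (σ.apply_symm_apply (z, c))
  have := hN (Finsupp.mem_support_iff.2 ha) (Finsupp.mem_support_iff.2 hb)
    ((hfst a).trans (hfst b).symm)
  exact congrArg Prod.snd (σ.symm.injective this)

theorem UnimodularRowsTrivial.of_ringEquiv {A B : Type*} [CommRing A] [CommRing B] (e : A ≃+* B)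
    (hA : UnimodularRowsTrivial A) : UnimodularRowsTrivial B := by
  intro s v ⟨y, hy⟩
  obtain ⟨i, hi⟩ := hA s (fun j => e.symm (v j)) ⟨fun j => e.symm (y j), by
    simpa [dotProduct] using congrArg e.symm hy⟩
  refine ⟨i, ?_⟩
  have h := hi.map (e : A →+* B)
  convert h using 2 with j j
  · simp
  · rcases eq_or_ne j i with rfl | hj
    · simp
    · simp [hj]

theorem unimodularRowsTrivial_field (k : Type*) [Field k] : UnimodularRowsTrivial k := by
  intro s v ⟨y, hy⟩
  obtain ⟨i, hi⟩ : ∃ i, v i ≠ 0 := by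
    by_contra! h
    simp [dotProduct, h] at hy
  exact ⟨i, RowEquiv.single_of_isUnit v i hi.isUnit⟩

theorem unimodularRowsTrivial_addMonoidAlgebra (k : Type*) [Field k] (n : ℕ) :
    UnimodularRowsTrivial k[Fin n → ℤ] := by
  cases n with
  | zero =>
    exact (unimodularRowsTrivial_field k).of_ringEquiv (uniqueRingEquiv (Fin 0 → ℤ)).symm
  | succ n =>
    intro s v ⟨y, hy⟩
    obtain ⟨i, hi⟩ : ∃ i, v i ≠ 0 := by
      by_contra! h
      simp [dotProduct, h] at hy
    obtain ⟨e, he⟩ := exists_ringEquiv_bimonic hi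
    have h := Bimonic.rowEquiv_single (fun j => e (v j)) he ⟨fun j => e (y j), by
      simpa [dotProduct] using congrArg e hy⟩
    refine ⟨i, ?_⟩
    have h := h.map (e.symm : (k[Fin n → ℤ])[T;T⁻¹] →+* k[Fin (n + 1) → ℤ])
    convert h using 2 with j j
    · simp
    · rcases eq_or_ne j i with rfl | hj
      · simp
      · simp [hj]

/-- Finite projective modules over a ring of Laurent polynomials in several variables over a field
are free. -/
theorem free_of_projective_addMonoidAlgebra.{u, v} {k : Type v} [Field k] (n : ℕ) :
    ∀ (P : Type u) [AddCommGroup P] [Module k[Fin n → ℤ] P] [Module.Projective k[Fin n → ℤ] P]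
      [Module.Finite k[Fin n → ℤ] P], Module.Free k[Fin n → ℤ] P := by
  induction n with
  | zero =>
    intro P _ _ _ _
    let e : k ≃+* k[Fin 0 → ℤ] := (uniqueRingEquiv (Fin 0 → ℤ)).symm
    let := Module.compHom P (e : k →+* k[Fin 0 → ℤ])
    have := RingHomInvPair.of_ringEquiv e
    have := RingHomInvPair.of_ringEquiv e.symm
    let l : P ≃ₛₗ[(e : k →+* k[Fin 0 → ℤ])] P :=
      { AddEquiv.refl P with map_smul' := fun _ _ => rfl }
    exact Module.Free.of_equiv l
  | succ n ih =>
    intro P _ _ _ _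
    obtain ⟨d, i, g, hi, hg0, hgi⟩ := Module.exists_injective_pi_smul_mem_range k[Fin (n + 1) → ℤ] P
    obtain ⟨e, he⟩ := exists_ringEquiv_bimonic hg0
    let := Module.compHom P (e.symm : (k[Fin n → ℤ])[T;T⁻¹] →+* k[Fin (n + 1) → ℤ])
    have := RingHomInvPair.of_ringEquiv e
    have : RingHomInvPair (e.symm : (k[Fin n → ℤ])[T;T⁻¹] →+* k[Fin (n + 1) → ℤ])
      (e : k[Fin (n + 1) → ℤ] →+* (k[Fin n → ℤ])[T;T⁻¹]) := RingHomInvPair.of_ringEquiv e.symm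
    let l : P ≃ₛₗ[(e.symm : (k[Fin n → ℤ])[T;T⁻¹] →+* k[Fin (n + 1) → ℤ])] P :=
      { AddEquiv.refl P with map_smul' := fun _ _ => rfl }
    have := Module.Projective.of_equiv l.symm
    have := Module.Finite.of_surjective l.symm.toLinearMap l.symm.surjective
    let i' : (Fin d → (k[Fin n → ℤ])[T;T⁻¹]) →ₗ[(k[Fin n → ℤ])[T;T⁻¹]] P :=
      { toFun := fun x => i (fun j => e.symm (x j))
        map_add' := fun x y => by
          rw [← map_add]
          exact congrArg i (funext fun j => map_add e.symm _ _)
        map_smul' := fun a x => by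
          refine Eq.trans (congrArg i (funext fun j => ?_)) (map_smul i (e.symm a) _)
          exact map_mul e.symm _ _ }
    have hi' : Injective i' := fun x y h => funext fun j => e.symm.injective (congrFun (hi h) j)
    have hgi' (x : P) : e g • x ∈ LinearMap.range i' := by
      obtain ⟨y, hy⟩ := hgi x
      refine ⟨fun j => e (y j), ?_⟩
      have h1 : i' (fun j => e (y j)) = i y := congrArg i (funext fun j => e.symm_apply_apply _)
      have h2 : e g • x = g • x := congrArg (· • x) (e.symm_apply_apply g)
      rw [h1, h2, hy]
    have := he.free_of_projective
      ((unimodularRowsTrivial_addMonoidAlgebra k (n + 1)).of_ringEquiv e) ih hi'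
      ((map_ne_zero_iff e e.injective).2 hg0) hgi'
    exact Module.Free.of_equiv l

end

section Algebra

open AddMonoidAlgebra

variable {k M : Type*} [Field k] [AddCommGroup M] [Module k M] {n : ℕ}

/-- A finitely generated module with an action of `ℤ ^ n` and equivariant coordinates admits an
equivariant basis. -/
theorem exists_equivariant_basis {U : (Fin n → ℤ) → M →ₗ[k] M} (hU0 : U 0 = LinearMap.id)
    (hUadd : ∀ g h, U (g + h) = U g ∘ₗ U h) {d : ℕ} (x : Fin d → M)
    (c : Fin d → M →ₗ[k] ((Fin n → ℤ) →₀ k)) (hcU : ∀ i h m g, c i (U h m) g = c i m (g - h))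
    (hc : ∀ m, ∑ i, (c i m).sum (fun g z => z • U g (x i)) = m) :
    ∃ (r : ℕ) (η : Fin r → M) (a : Fin r → Fin d → ((Fin n → ℤ) →₀ k))
      (c' : Fin r → M → ((Fin n → ℤ) →₀ k)),
      (∀ j m g, c' j m g = ∑ i, (a j i).sum fun h z => z * c i m (g - h)) ∧
      (∀ m, ∑ j, (c' j m).sum (fun g z => z • U g (η j)) = m) ∧
      ∀ i j, c' j (η i) = if i = j then Finsupp.single 0 1 else 0 := by
  let A := k[Fin n → ℤ]
  let ρ : Multiplicative (Fin n → ℤ) →* Module.End k M :=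
    { toFun := fun g => U g.toAdd
      map_one' := hU0
      map_mul' := fun g h => hUadd _ _ }
  let Φ : A →ₐ[k] Module.End k M := AddMonoidAlgebra.lift k (Module.End k M) (Fin n → ℤ) ρ
  let : Module A M := Module.compHom M (Φ : A →+* Module.End k M)
  have hsmul (f : A) (m : M) : f • m = f.coeff.sum fun g z => z • U g m := by
    have h : Φ f = f.coeff.sum fun g z => z • U g := AddMonoidAlgebra.lift_apply ρ f
    change Φ f m = _
    rw [h, Finsupp.sum, LinearMap.sum_apply]
    rfl
  have hsingle (g : Fin n → ℤ) (z : k) (m : M) : (single g z : A) • m = z • U g m := by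
    rw [hsmul, coeff_single]
    exact Finsupp.sum_single_index (zero_smul _ _)
  let φ (i : Fin d) : M →ₗ[A] A :=
    { toFun := fun m => ofCoeff (c i m)
      map_add' := fun m m' => by rw [map_add, ofCoeff_add]
      map_smul' := fun f m => by
        induction f using AddMonoidAlgebra.induction_linear with
        | zero => simp
        | add f f' hf hf' =>
          simp only [add_smul, map_add, ofCoeff_add, RingHom.id_apply, smul_eq_mul, add_mul] at *
          rw [hf, hf']
        | single h z =>
          rw [hsingle]
          refine coeff_inj.1 (Finsupp.ext fun g => ?_)
          rw [RingHom.id_apply, smul_eq_mul]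
          have := AddMonoidAlgebra.coeff_single_mul_add (ofCoeff (c i m)) z h (g - h)
          rw [add_sub_cancel] at this
          rw [this]
          simp [hcU] }
  have hsum (m : M) : ∑ i, φ i m • x i = m := by
    conv_rhs => rw [← hc m]
    exact Finset.sum_congr rfl fun i _ => hsmul _ _
  let π : (Fin d → A) →ₗ[A] M := Fintype.linearCombination A x
  have hπ : π ∘ₗ LinearMap.pi φ = LinearMap.id := LinearMap.ext hsum
  have : Module.Projective A M := Module.Projective.of_split _ π hπ
  have : Module.Finite A M :=
    Module.Finite.of_surjective π fun m => ⟨LinearMap.pi φ m, LinearMap.congr_fun hπ m⟩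
  have := free_of_projective_addMonoidAlgebra (k := k) n M
  let b := Module.finBasis A M
  refine ⟨Module.finrank A M, b, fun j i => (b.repr (x i) j).coeff, fun j m => (b.repr m j).coeff,
    fun j m g => ?_, fun m => ?_, fun i j => ?_⟩
  · have h1 : b.repr m j = ∑ i, b.repr (x i) j * φ i m := by
      conv_lhs => rw [← hsum m]
      simp [mul_comm]
    change (b.repr m j).coeff g = ∑ i, (b.repr (x i) j).coeff.sum fun h z => z * c i m (g - h)
    rw [h1, coeff_sum, Finsupp.finsetSum_apply]
    refine Finset.sum_congr rfl fun i _ => ?_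
    rw [AddMonoidAlgebra.coeff_mul_apply_left]
    simp only [neg_add_eq_sub]
    rfl
  · conv_rhs => rw [← b.sum_repr m]
    exact Finset.sum_congr rfl fun j _ => (hsmul _ _).symm
  · change (b.repr (b i) j).coeff = _
    rw [b.repr_self, Finsupp.single_apply]
    split_ifs <;> rfl

end Algebra

section Bessel

open Filter Topology

variable {H ι : Type*} [NormedAddCommGroup H] [InnerProductSpace ℂ H]

/-- The family `e` satisfies a Bessel inequality on `K` with bound `B`. -/
def IsBessel (K : Submodule ℂ H) (e : ι → H) (B : ℝ) : Prop :=
  ∀ ζ ∈ K, ∀ F : Finset ι, ∑ p ∈ F, ‖inner ℂ (e p) ζ‖ ^ 2 ≤ B * ‖ζ‖ ^ 2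

variable {K : Submodule ℂ H} {e f : ι → H} {B B' : ℝ}

theorem IsBessel.mono (h : IsBessel K e B) (hB : B ≤ B') : IsBessel K e B' := fun ζ hζ F =>
  (h ζ hζ F).trans (by gcongr)

theorem IsBessel.summable (h : IsBessel K e B) {ζ : H} (hζ : ζ ∈ K) :
    Summable fun p => ‖inner ℂ (e p) ζ‖ ^ 2 :=
  summable_of_sum_le (fun _ => by positivity) (h ζ hζ)

theorem IsBessel.norm_sum_smul_sq_le (h : IsBessel K e B) (hB : 0 ≤ B) (he : ∀ p, e p ∈ K)
    (c : ι → ℂ) (F : Finset ι) :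
    ‖∑ p ∈ F, c p • e p‖ ^ 2 ≤ B * ∑ p ∈ F, ‖c p‖ ^ 2 := by
  set y := ∑ p ∈ F, c p • e p with hy
  have hyK : y ∈ K := K.sum_mem fun p _ => K.smul_mem _ (he p)
  have h1 : ‖y‖ ^ 2 ≤ ∑ p ∈ F, ‖c p‖ * ‖inner ℂ (e p) y‖ := by
    have h2 : (inner ℂ y y : ℂ) = ∑ p ∈ F, c p * inner ℂ y (e p) := by
      conv_lhs => arg 3; rw [hy]
      simp only [inner_sum, inner_smul_right]
    have h3 : ‖y‖ ^ 2 = ‖(inner ℂ y y : ℂ)‖ := by rw [inner_self_eq_norm_sq_to_K]; simp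
    rw [h3, h2]
    refine (norm_sum_le _ _).trans_eq (Finset.sum_congr rfl fun p _ => ?_)
    rw [norm_mul, norm_inner_symm]
  have h3 : (‖y‖ ^ 2) ^ 2 ≤ (∑ p ∈ F, ‖c p‖ ^ 2) * (B * ‖y‖ ^ 2) :=
    calc (‖y‖ ^ 2) ^ 2 ≤ (∑ p ∈ F, ‖c p‖ * ‖inner ℂ (e p) y‖) ^ 2 := by gcongr
      _ ≤ (∑ p ∈ F, ‖c p‖ ^ 2) * ∑ p ∈ F, ‖inner ℂ (e p) y‖ ^ 2 :=
        Finset.sum_mul_sq_le_sq_mul_sq _ _ _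
      _ ≤ _ := by gcongr; exact h y hyK F
  rcases eq_or_ne y 0 with h0 | h0
  · rw [h0]; simp; positivity
  · have : 0 < ‖y‖ ^ 2 := by positivity
    nlinarith

theorem IsBessel.norm_sum_inner_smul_le (he : IsBessel K e B) (hf : IsBessel K f B)
    (hB : 0 ≤ B) (hfK : ∀ p, f p ∈ K) {ζ : H} (hζ : ζ ∈ K) (F : Finset ι) :
    ‖∑ p ∈ F, (inner ℂ (e p) ζ : ℂ) • f p‖ ≤ B * ‖ζ‖ := by
  refine le_of_sq_le_sq ?_ (by positivity)
  calc _ ≤ B * ∑ p ∈ F, ‖(inner ℂ (e p) ζ : ℂ)‖ ^ 2 := hf.norm_sum_smul_sq_le hB hfK _ F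
    _ ≤ B * (B * ‖ζ‖ ^ 2) := by gcongr; exact he ζ hζ F
    _ = _ := by ring

theorem IsBessel.hasSum_of_dense (he : IsBessel K e B) (hf : IsBessel K f B) (hB : 0 ≤ B)
    (hfK : ∀ p, f p ∈ K) {D : Submodule ℂ H} (hDK : D ≤ K)
    (hdense : (K : Set H) ⊆ closure D)
    (hD : ∀ ζ ∈ D, HasSum (fun p => (inner ℂ (e p) ζ : ℂ) • f p) ζ) {ζ : H} (hζ : ζ ∈ K) :
    HasSum (fun p => (inner ℂ (e p) ζ : ℂ) • f p) ζ := by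
  refine Metric.tendsto_nhds.2 fun ε hε => ?_
  obtain ⟨δ, hδ, hd⟩ := Metric.mem_closure_iff.1 (hdense hζ) (ε / (2 * (B + 1))) (by positivity)
  rw [dist_eq_norm, lt_div_iff₀ (by positivity)] at hd
  filter_upwards [Metric.tendsto_nhds.1 (hD δ hδ) (ε / 2) (by positivity)] with F hF
  rw [dist_eq_norm] at hF ⊢
  have h1 := he.norm_sum_inner_smul_le hf hB hfK (K.sub_mem hζ (hDK hδ)) F
  have h2 : ∑ p ∈ F, (inner ℂ (e p) ζ : ℂ) • f p - ζ =
      (∑ p ∈ F, (inner ℂ (e p) (ζ - δ) : ℂ) • f p) +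
        (∑ p ∈ F, (inner ℂ (e p) δ : ℂ) • f p - δ) - (ζ - δ) := by
    simp only [inner_sub_right, sub_smul, Finset.sum_sub_distrib]
    abel
  rw [h2]
  have h3 := norm_sub_le ((∑ p ∈ F, (inner ℂ (e p) (ζ - δ) : ℂ) • f p) +
    (∑ p ∈ F, (inner ℂ (e p) δ : ℂ) • f p - δ)) (ζ - δ)
  have h4 := norm_add_le (∑ p ∈ F, (inner ℂ (e p) (ζ - δ) : ℂ) • f p)
    (∑ p ∈ F, (inner ℂ (e p) δ : ℂ) • f p - δ)
  linarith

theorem IsBessel.norm_sq_le_tsum (hf : IsBessel K f B) (hB : 0 ≤ B) (hfK : ∀ p, f p ∈ K)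
    {c : ι → ℂ} (hc : Summable fun p => ‖c p‖ ^ 2) {ζ : H} (h : HasSum (fun p => c p • f p) ζ) :
    ‖ζ‖ ^ 2 ≤ B * ∑' p, ‖c p‖ ^ 2 := by
  refine le_of_tendsto (h.norm.pow 2) (Eventually.of_forall fun F => ?_)
  refine (hf.norm_sum_smul_sq_le hB hfK _ F).trans ?_
  gcongr
  exact hc.sum_le_tsum F fun _ _ => by positivity

/-- A family all of whose members `i` give Bessel families is a Bessel family. -/
theorem IsBessel.prod {κ : Type*} [Fintype κ] {e : ι × κ → H} {B : κ → ℝ}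
    (h : ∀ i, IsBessel K (fun g => e (g, i)) (B i)) : IsBessel K e (∑ i, B i) := by
  classical
  intro ζ hζ F
  calc ∑ p ∈ F, ‖inner ℂ (e p) ζ‖ ^ 2
      ≤ ∑ p ∈ F.image Prod.fst ×ˢ Finset.univ, ‖inner ℂ (e p) ζ‖ ^ 2 :=
        Finset.sum_le_sum_of_subset_of_nonneg
          (fun p hp => Finset.mem_product.2 ⟨Finset.mem_image_of_mem _ hp, Finset.mem_univ _⟩)
          fun _ _ _ => by positivity
    _ = ∑ i, ∑ g ∈ F.image Prod.fst, ‖inner ℂ (e (g, i)) ζ‖ ^ 2 := Finset.sum_product_right _ _ _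
    _ ≤ ∑ i, B i * ‖ζ‖ ^ 2 := Finset.sum_le_sum fun i _ => h i ζ hζ _
    _ = _ := (Finset.sum_mul _ _ _).symm

variable {G : Type*} [AddCommGroup G]

/-- The vectors whose orbit under `ν` is a Bessel family. -/
def besselVectors (K : Submodule ℂ H) (ν : G → H →ₗ[ℂ] H) : Submodule ℂ H where
  carrier := {x | ∃ B, IsBessel K (fun g => ν g x) B}
  zero_mem' := ⟨0, fun ζ _ F => by simp⟩
  add_mem' := by
    rintro x y ⟨B, hB⟩ ⟨B', hB'⟩
    refine ⟨2 * B + 2 * B', fun ζ hζ F => ?_⟩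
    have h (g : G) : ‖inner ℂ (ν g (x + y)) ζ‖ ^ 2 ≤
        2 * ‖inner ℂ (ν g x) ζ‖ ^ 2 + 2 * ‖inner ℂ (ν g y) ζ‖ ^ 2 := by
      rw [map_add, inner_add_left]
      nlinarith [norm_add_le (inner ℂ (ν g x) ζ) (inner ℂ (ν g y) ζ),
        norm_nonneg (inner ℂ (ν g x) ζ + inner ℂ (ν g y) ζ),
        sq_nonneg (‖inner ℂ (ν g x) ζ‖ - ‖inner ℂ (ν g y) ζ‖)]
    refine (Finset.sum_le_sum fun g _ => h g).trans ?_
    rw [Finset.sum_add_distrib, ← Finset.mul_sum, ← Finset.mul_sum]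
    linarith [hB ζ hζ F, hB' ζ hζ F]
  smul_mem' := by
    rintro z x ⟨B, hB⟩
    refine ⟨‖z‖ ^ 2 * B, fun ζ hζ F => ?_⟩
    simp only [map_smul, inner_smul_left, norm_mul, RCLike.norm_conj, mul_pow]
    rw [← Finset.mul_sum, mul_assoc]
    gcongr
    exact hB ζ hζ F

theorem map_mem_besselVectors {ν : G → H →ₗ[ℂ] H}
    (hν : ∀ g h x, ν (g + h) x = ν g (ν h x)) (h : G) {x : H} (hx : x ∈ besselVectors K ν) :
    ν h x ∈ besselVectors K ν := by
  obtain ⟨B, hB⟩ := hx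
  refine ⟨B, fun ζ hζ F => ?_⟩
  have := hB ζ hζ (F.map (addRightEmbedding h))
  simpa [hν] using this

end Bessel

section Expansion

open Filter Topology
open scoped ComplexConjugate

variable {H ι : Type*} [NormedAddCommGroup H] [InnerProductSpace ℂ H]

theorem hasSum_finsupp_smul {G : Type*} {r : ℕ} (c : Fin r → (G →₀ ℂ)) (v : G → Fin r → H) :
    HasSum (fun p : G × Fin r => c p.2 p.1 • v p.1 p.2)
      (∑ j, (c j).sum fun g z => z • v g j) := by
  classical
  let F : Finset G := Finset.univ.biUnion fun j => (c j).support
  have hF (j : Fin r) : (c j).support ⊆ F :=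
    Finset.subset_biUnion_of_mem (fun j => (c j).support) (Finset.mem_univ j)
  have h : ∑ j, (c j).sum (fun g z => z • v g j) =
      ∑ p ∈ F ×ˢ Finset.univ, c p.2 p.1 • v p.1 p.2 := by
    rw [Finset.sum_product_right]
    exact Finset.sum_congr rfl fun j _ =>
      Finsupp.sum_of_support_subset _ (hF j) _ fun g _ => zero_smul _ _
  rw [h]
  refine hasSum_sum_of_ne_finset_zero fun p hp => ?_
  have : p.1 ∉ (c p.2).support := fun h => hp (Finset.mem_product.2 ⟨hF _ h, Finset.mem_univ _⟩)
  rw [Finsupp.notMem_support_iff.1 this, zero_smul]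

theorem eq_of_hasSum_inner_smul_swap {M : Submodule ℂ H} {e f : ι → H}
    (h : ∀ m ∈ M, HasSum (fun p => (inner ℂ (e p) m : ℂ) • f p) m) {m y : H} (hm : m ∈ M)
    (hy : y ∈ M) (hsum : HasSum (fun p => (inner ℂ (f p) m : ℂ) • e p) y) : y = m := by
  have key (u : H) (hu : u ∈ M) : (inner ℂ u y : ℂ) = inner ℂ u m := by
    have h1 := (innerSL ℂ u).hasSum hsum
    have h2 := ((innerSL ℂ m).hasSum (h u hu)).star
    simp only [innerSL_apply_apply, inner_smul_right, star_mul',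
      RCLike.star_def, inner_conj_symm] at h1 h2
    simp only [mul_comm] at h1 h2
    exact h1.unique h2
  have h3 := key (y - m) (M.sub_mem hy hm)
  rw [← sub_eq_zero, ← inner_sub_right, inner_self_eq_zero, sub_eq_zero] at h3
  exact h3

variable {n d : ℕ} {ν : (Fin n → ℤ) → H →ₗ[ℂ] H}

theorem exists_biorthogonal_expansion (hν0 : ∀ x, ν 0 x = x)
    (hνadd : ∀ g h x, ν (g + h) x = ν g (ν h x))
    (hνinner : ∀ g x y, (inner ℂ (ν g x) (ν g y) : ℂ) = inner ℂ x y)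
    {M : Submodule ℂ H} (hM : ∀ g, ∀ x ∈ M, ν g x ∈ M)
    (hfin : ∀ x ∈ M, ∀ y ∈ M, {g | (inner ℂ (ν g x) y : ℂ) ≠ 0}.Finite)
    {x xt : Fin d → H} (hx : ∀ i, x i ∈ M) (hxt : ∀ i, xt i ∈ M)
    (hexp : ∀ m ∈ M, HasSum (fun p : (Fin n → ℤ) × Fin d =>
      (inner ℂ (ν p.1 (xt p.2)) m : ℂ) • ν p.1 (x p.2)) m) :
    ∃ (r : ℕ) (η ηt : Fin r → H), (∀ j, η j ∈ M) ∧ (∀ j, ηt j ∈ M) ∧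
      (∀ m ∈ M, HasSum (fun p : (Fin n → ℤ) × Fin r =>
        (inner ℂ (ν p.1 (ηt p.2)) m : ℂ) • ν p.1 (η p.2)) m) ∧
      (∀ m ∈ M, HasSum (fun p : (Fin n → ℤ) × Fin r =>
        (inner ℂ (ν p.1 (η p.2)) m : ℂ) • ν p.1 (ηt p.2)) m) ∧
      ∀ g g' i j, (inner ℂ (ν g' (ηt j)) (ν g (η i)) : ℂ) = if g = g' ∧ i = j then 1 else 0 := by
  classical
  have hνsub (g h : Fin n → ℤ) (x y : H) :
      (inner ℂ (ν g x) (ν h y) : ℂ) = inner ℂ (ν (g - h) x) y := by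
    rw [← hνinner h (ν (g - h) x), ← hνadd, add_sub_cancel]
  let U (g : Fin n → ℤ) : M →ₗ[ℂ] M := (ν g).restrict (hM g)
  let C (y : M) : M →ₗ[ℂ] ((Fin n → ℤ) →₀ ℂ) :=
    { toFun := fun m => Finsupp.ofSupportFinite (fun g => inner ℂ (ν g (y : H)) (m : H))
        (hfin y y.2 m m.2)
      map_add' := fun m m' => Finsupp.ext fun g => inner_add_right _ _ _
      map_smul' := fun z m => Finsupp.ext fun g => inner_smul_right _ _ _ }
  have hC (y m : M) (g : Fin n → ℤ) : C y m g = inner ℂ (ν g (y : H)) (m : H) := rfl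
  obtain ⟨r, η, a, c', hc', hsum, hdelta⟩ := exists_equivariant_basis (U := U)
    (LinearMap.ext fun m => Subtype.ext (hν0 m))
    (fun g h => LinearMap.ext fun m => Subtype.ext (hνadd g h m))
    (fun i => ⟨x i, hx i⟩) (fun i => C ⟨xt i, hxt i⟩)
    (fun i h m g => hνsub g h _ _) fun m => by
      refine Subtype.ext ((hasSum_finsupp_smul (fun i => C ⟨xt i, hxt i⟩ m)
        fun g i => ν g (x i)).unique (hexp m m.2) ▸ ?_)
      simp [Finsupp.sum, U]
  let ηt (j : Fin r) : M :=
    ∑ i, (a j i).sum fun h z => conj z • U (-h) ⟨xt i, hxt i⟩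
  have hηt (j : Fin r) (m : M) : c' j m = C (ηt j) m := by
    refine Finsupp.ext fun g => ?_
    rw [hc', hC]
    simp only [ηt, Finsupp.sum, Submodule.coe_sum, map_sum, sum_inner, Submodule.coe_smul,
      map_smul, inner_smul_left, RCLike.conj_conj]
    refine Finset.sum_congr rfl fun i _ => Finset.sum_congr rfl fun h _ => ?_
    rw [hC, sub_eq_add_neg, hνadd]
    rfl
  have hexp' (m : H) (hm : m ∈ M) : HasSum (fun p : (Fin n → ℤ) × Fin r =>
      (inner ℂ (ν p.1 (ηt p.2 : H)) m : ℂ) • ν p.1 (η p.2 : H)) m := by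
    have h1 := hasSum_finsupp_smul (fun j => c' j ⟨m, hm⟩) fun g j => ν g (η j : H)
    have h2 := congrArg (Subtype.val : M → H) (hsum ⟨m, hm⟩)
    simp only [hηt, Finsupp.sum, Submodule.coe_sum, Submodule.coe_smul] at h1 h2
    convert h1 using 1
    · rfl
    · exact h2.symm
  refine ⟨r, fun j => η j, fun j => ηt j, fun j => (η j).2, fun j => (ηt j).2, hexp',
    fun m hm => ?_, fun g g' i j => ?_⟩
  · have h1 := hasSum_finsupp_smul (fun j => C (η j) ⟨m, hm⟩) fun g j => ν g (ηt j : H)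
    have h2 := eq_of_hasSum_inner_smul_swap hexp' hm (M.sum_mem fun j _ => M.sum_mem fun g _ =>
      M.smul_mem _ (hM _ _ (ηt j).2)) h1
    simp only [Finsupp.sum] at h1
    rwa [h2] at h1
  · rw [hνsub, ← hC, ← hηt, hdelta]
    by_cases hij : i = j
    · by_cases hg : g = g'
      · simp [hij, hg]
      · simp [hij, hg, sub_eq_zero, eq_comm]
    · simp [hij]

end Expansion

section Frame

open Filter Topology

variable {H : Type*} [NormedAddCommGroup H] [InnerProductSpace ℂ H]

theorem HasSum.mem_of_finite_support {ι : Type*} {V : Submodule ℂ H} {f : ι → H} {m : H}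
    (h : HasSum f m) (hf : f.support.Finite) (hV : ∀ p, f p ∈ V) : m ∈ V := by
  rw [h.unique (hasSum_sum_of_ne_finset_zero (s := hf.toFinset) fun p hp => by simpa using hp)]
  exact V.sum_mem fun p _ => hV p

theorem exists_biorthogonal_frame {n d : ℕ} {ν : (Fin n → ℤ) → H ≃ₗᵢ[ℂ] H}
    (hν0 : ∀ x, ν 0 x = x) (hνadd : ∀ g h x, ν (g + h) x = ν g (ν h x))
    {S K : Submodule ℂ H} (hS : ∀ g, ∀ x ∈ S, ν g x ∈ S) (hK : IsClosed (K : Set H))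
    (hfin : ∀ x ∈ S, ∀ y ∈ S, {g | (inner ℂ (ν g x) y : ℂ) ≠ 0}.Finite)
    {x xt : Fin d → H} (hx : ∀ i, x i ∈ S) (hxt : ∀ i, xt i ∈ S)
    (hxK : ∀ g i, ν g (x i) ∈ K) (hxtK : ∀ g i, ν g (xt i) ∈ K)
    (hB : ∀ i, ∃ B, IsBessel K (fun g => ν g (x i)) B)
    (hexp : ∀ m ∈ K, HasSum (fun p : (Fin n → ℤ) × Fin d =>
      (inner ℂ (ν p.1 (xt p.2)) m : ℂ) • ν p.1 (x p.2)) m) :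
    ∃ (r : ℕ) (η ηt : Fin r → H) (B : ℝ), 0 < B ∧
      (∀ j, η j ∈ S ⊓ K) ∧ (∀ j, ηt j ∈ S ⊓ K) ∧
      (∀ g, ∀ x ∈ K, ν g x ∈ K) ∧
      IsBessel K (fun p : (Fin n → ℤ) × Fin r => ν p.1 (η p.2)) B ∧
      IsBessel K (fun p : (Fin n → ℤ) × Fin r => ν p.1 (ηt p.2)) B ∧
      (∀ m ∈ K, HasSum (fun p : (Fin n → ℤ) × Fin r =>
        (inner ℂ (ν p.1 (ηt p.2)) m : ℂ) • ν p.1 (η p.2)) m) ∧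
      (∀ m ∈ K, HasSum (fun p : (Fin n → ℤ) × Fin r =>
        (inner ℂ (ν p.1 (η p.2)) m : ℂ) • ν p.1 (ηt p.2)) m) ∧
      ∀ g g' i j, (inner ℂ (ν g' (ηt j)) (ν g (η i)) : ℂ) = if g = g' ∧ i = j then 1 else 0 := by
  let μ (g : Fin n → ℤ) : H →ₗ[ℂ] H := (ν g).toLinearIsometry.toLinearMap
  have hKν (g : Fin n → ℤ) (m : H) (hm : m ∈ K) : ν g m ∈ K := by
    have h := (((ν g).continuous.tendsto m).comp (hexp m hm))
    refine hK.mem_of_tendsto h (Eventually.of_forall fun F => ?_)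
    simp only [Function.comp_apply, map_sum, map_smul, ← hνadd]
    exact K.sum_mem fun p _ => K.smul_mem _ (hxK _ _)
  have hdense : (K : Set H) ⊆ closure (S ⊓ K : Submodule ℂ H) := fun m hm =>
    mem_closure_of_tendsto (hexp m hm) <| Eventually.of_forall fun F =>
      (S ⊓ K).sum_mem fun p _ => (S ⊓ K).smul_mem _ ⟨hS _ _ (hx _), hxK _ _⟩
  have hxM (i : Fin d) : x i ∈ S ⊓ K := ⟨hx i, hν0 (x i) ▸ hxK 0 i⟩
  have hxtM (i : Fin d) : xt i ∈ S ⊓ K := ⟨hxt i, hν0 (xt i) ▸ hxtK 0 i⟩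
  obtain ⟨r, η, ηt, hη, hηt, h1, h2, h3⟩ := exists_biorthogonal_expansion (ν := μ) hν0 hνadd
    (fun g => (ν g).inner_map_map) (M := S ⊓ K) (fun g m hm => ⟨hS g m hm.1, hKν g m hm.2⟩)
    (fun y hy z hz => hfin y hy.1 z hz.1) hxM hxtM fun m hm => hexp m hm.2
  have hbes (m : H) (hm : m ∈ S ⊓ K) : m ∈ besselVectors K μ := by
    refine (hexp m hm.2).mem_of_finite_support ?_ fun p =>
      Submodule.smul_mem _ _ (map_mem_besselVectors hνadd p.1 (hB p.2))
    refine (Set.finite_iUnion fun i => (hfin _ (hxt i) m hm.1).prod (Set.finite_singleton i)).subset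
      fun p hp => Set.mem_iUnion.2 ⟨p.2, ?_, rfl⟩
    exact fun h0 => hp (by simp only [h0, zero_smul])
  choose B hB using fun j => hbes _ (hη j)
  choose B' hB' using fun j => hbes _ (hηt j)
  have hb := IsBessel.prod (e := fun p : (Fin n → ℤ) × Fin r => ν p.1 (η p.2)) hB
  have hb' := IsBessel.prod (e := fun p : (Fin n → ℤ) × Fin r => ν p.1 (ηt p.2)) hB'
  let C := max 1 (max (∑ j, B j) (∑ j, B' j))
  have hC : 0 < C := one_pos.trans_le (le_max_left _ _)
  replace hb := hb.mono (B' := C) ((le_max_left _ _).trans (le_max_right _ _))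
  replace hb' := hb'.mono (B' := C) ((le_max_right _ _).trans (le_max_right _ _))
  exact ⟨r, η, ηt, C, hC, hη, hηt, hKν, hb, hb',
    fun m hm => hb'.hasSum_of_dense hb hC.le (fun p => hKν _ _ (hη _).2) inf_le_right hdense h1 hm,
    fun m hm => hb.hasSum_of_dense hb' hC.le (fun p => hKν _ _ (hηt _).2) inf_le_right hdense h2 hm,
    h3⟩

end Frame

section Translation

open Filter

variable {n : ℕ} {ν : (Fin n → ℤ) → (L2Rn n ≃ₗᵢ[ℂ] L2Rn n)}

theorem translation_zero
    (hν : ∀ g (ζ : L2Rn n), ∀ᵐ x : Fin n → ℝ, ν g ζ x = ζ (x - fun i => (g i : ℝ)))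
    (ζ : L2Rn n) : ν 0 ζ = ζ := by
  refine Lp.ext ?_
  filter_upwards [hν 0 ζ] with x hx
  have h0 : (fun i => ((0 : Fin n → ℤ) i : ℝ)) = 0 := by ext; simp
  rw [hx, h0, sub_zero]

theorem ae_sub_right {p : (Fin n → ℝ) → Prop} (h : ∀ᵐ x, p x) (v : Fin n → ℝ) :
    ∀ᵐ x, p (x - v) :=
  (measurePreserving_sub_right volume v).quasiMeasurePreserving.ae h

theorem translation_add
    (hν : ∀ g (ζ : L2Rn n), ∀ᵐ x : Fin n → ℝ, ν g ζ x = ζ (x - fun i => (g i : ℝ)))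
    (g h : Fin n → ℤ) (ζ : L2Rn n) : ν (g + h) ζ = ν g (ν h ζ) := by
  refine Lp.ext ?_
  filter_upwards [hν (g + h) ζ, hν g (ν h ζ), ae_sub_right (hν h ζ) fun i => (g i : ℝ)]
    with x h1 h2 h3
  rw [h1, h2, h3, sub_sub]
  congr 2
  ext i
  simp

/-- The compactly supported elements of `L²(ℝⁿ)`. -/
def compSuppSubmodule (n : ℕ) : Submodule ℂ (L2Rn n) where
  carrier := {ζ | CompSupp ζ}
  zero_mem' := ⟨∅, isCompact_empty, by
    filter_upwards [Lp.coeFn_zero ℂ 2 (volume : Measure (Fin n → ℝ))] with x hx _ using hx⟩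
  add_mem' := by
    rintro ζ ζ' ⟨K, hK, h⟩ ⟨K', hK', h'⟩
    refine ⟨K ∪ K', hK.union hK', ?_⟩
    filter_upwards [Lp.coeFn_add ζ ζ', h, h'] with x hx h1 h2 hxK
    rw [hx, Pi.add_apply, h1 fun h => hxK (Or.inl h), h2 fun h => hxK (Or.inr h), add_zero]
  smul_mem' := by
    rintro z ζ ⟨K, hK, h⟩
    refine ⟨K, hK, ?_⟩
    filter_upwards [Lp.coeFn_smul z ζ, h] with x hx h1 hxK
    rw [hx, Pi.smul_apply, h1 hxK, smul_zero]

theorem CompSupp.translation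
    (hν : ∀ g (ζ : L2Rn n), ∀ᵐ x : Fin n → ℝ, ν g ζ x = ζ (x - fun i => (g i : ℝ)))
    (g : Fin n → ℤ) {ζ : L2Rn n} (h : CompSupp ζ) : CompSupp (ν g ζ) := by
  obtain ⟨K, hK, h⟩ := h
  refine ⟨(fun x => x + fun i => (g i : ℝ)) '' K, hK.image (by fun_prop), ?_⟩
  filter_upwards [hν g ζ, ae_sub_right h fun i => (g i : ℝ)] with x h1 h2 hx
  rw [h1]
  exact h2 fun hxK => hx ⟨_, hxK, sub_add_cancel _ _⟩

theorem finite_intCast_mem_of_isCompact {C : Set (Fin n → ℝ)} (hC : IsCompact C) :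
    {g : Fin n → ℤ | (fun i => (g i : ℝ)) ∈ C}.Finite := by
  obtain ⟨R, hR⟩ := hC.isBounded.exists_norm_le
  refine (Set.finite_Icc (fun _ => -⌈R⌉ : Fin n → ℤ) fun _ => ⌈R⌉).subset fun g hg => ?_
  have h (i : Fin n) : |(g i : ℝ)| ≤ R := (norm_le_pi_norm _ i).trans (hR _ hg)
  refine ⟨fun i => ?_, fun i => ?_⟩
  · have h1 : (-(g i) : ℝ) ≤ ⌈R⌉ := (neg_le_abs _).trans ((h i).trans (Int.le_ceil R))
    have h2 : -(g i) ≤ ⌈R⌉ := by exact_mod_cast h1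
    exact neg_le.1 h2
  · have h1 : (g i : ℝ) ≤ ⌈R⌉ := (le_abs_self _).trans ((h i).trans (Int.le_ceil R))
    exact_mod_cast h1

theorem CompSupp.finite_inner_translation_ne_zero
    (hν : ∀ g (ζ : L2Rn n), ∀ᵐ x : Fin n → ℝ, ν g ζ x = ζ (x - fun i => (g i : ℝ)))
    {ζ ζ' : L2Rn n} (h : CompSupp ζ) (h' : CompSupp ζ') :
    {g | (inner ℂ (ν g ζ) ζ' : ℂ) ≠ 0}.Finite := by
  obtain ⟨K, hK, h⟩ := h
  obtain ⟨K', hK', h'⟩ := h'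
  refine (finite_intCast_mem_of_isCompact ((hK'.prod hK).image
    (continuous_fst.sub continuous_snd))).subset fun g hg => ?_
  by_contra hgK
  refine hg ?_
  rw [L2.inner_def]
  refine integral_eq_zero_of_ae ?_
  filter_upwards [hν g ζ, ae_sub_right h fun i => (g i : ℝ), h'] with x h1 h2 h3
  by_cases hx : x ∈ K'
  · have : x - (fun i => (g i : ℝ)) ∉ K := fun hxK => hgK ⟨(x, _), ⟨hx, hxK⟩, sub_sub_cancel _ _⟩
    rw [h1, h2 this, inner_zero_left, Pi.zero_apply]
  · rw [h3 hx, inner_zero_right, Pi.zero_apply]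

theorem IsGFrame.exists_isBessel {d : ℕ} {ζs : Fin d → L2Rn n} {K : Submodule ℂ (L2Rn n)}
    (h : IsGFrame ν ζs (K : Set (L2Rn n))) (i : Fin d) :
    ∃ B, IsBessel K (fun g => ν g (ζs i)) B := by
  obtain ⟨-, A, B, hA, -, h⟩ := h
  refine ⟨B, fun ζ hζ F => ?_⟩
  obtain ⟨h1, h2⟩ := h ζ hζ
  by_cases hs : Summable fun g : Fin n → ℤ => ∑ i, ‖ipp ζ (ν g (ζs i))‖ ^ 2
  · refine le_trans ?_ ((hs.sum_le_tsum F fun _ _ => by positivity).trans h2)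
    exact Finset.sum_le_sum fun g _ => Finset.single_le_sum
      (f := fun i => ‖ipp ζ (ν g (ζs i))‖ ^ 2) (fun _ _ => by positivity) (Finset.mem_univ i)
  · rw [tsum_eq_zero_of_not_summable hs] at h1
    have h3 : ‖ζ‖ ^ 2 = 0 := le_antisymm (by nlinarith) (by positivity)
    have h4 : ζ = 0 := by simpa using h3
    simp [h4]

theorem IsBessel.isGFrame {r : ℕ} {η ηt : Fin r → L2Rn n} {K : Submodule ℂ (L2Rn n)} {B : ℝ}
    (hB : 0 < B) (h : IsBessel K (fun p : (Fin n → ℤ) × Fin r => ν p.1 (η p.2)) B)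
    (ht : IsBessel K (fun p : (Fin n → ℤ) × Fin r => ν p.1 (ηt p.2)) B)
    (hη : ∀ g i, ν g (η i) ∈ K) (hηt : ∀ g i, ν g (ηt i) ∈ K)
    (hexp : ∀ m ∈ K, HasSum (fun p : (Fin n → ℤ) × Fin r =>
      (inner ℂ (ν p.1 (η p.2)) m : ℂ) • ν p.1 (ηt p.2)) m) :
    IsGFrame ν η (K : Set (L2Rn n)) := by
  refine ⟨hη, B⁻¹, B, by positivity, hB, fun ζ hζ => ?_⟩
  have hs := h.summable hζ
  have h1 : ∑' p : (Fin n → ℤ) × Fin r, ‖inner ℂ (ν p.1 (η p.2)) ζ‖ ^ 2 =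
      ∑' g : Fin n → ℤ, ∑ i, ‖ipp ζ (ν g (η i))‖ ^ 2 := by
    rw [hs.tsum_prod]
    exact tsum_congr fun g => tsum_fintype _
  rw [← h1]
  refine ⟨?_, hs.tsum_le_of_sum_le (h ζ hζ)⟩
  rw [inv_mul_le_iff₀ hB]
  exact ht.norm_sq_le_tsum hB.le (fun p => hηt _ _) hs (hexp ζ hζ)

end Translation

theorem statement11
    (n : ℕ)
    (ν : (Fin n → ℤ) → (L2Rn n ≃ₗᵢ[ℂ] L2Rn n))
    (hν : ∀ (g : Fin n → ℤ) (ζ : L2Rn n),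
      ∀ᵐ x : Fin n → ℝ, (ν g ζ : L2Rn n) x = ζ (x - fun i => (g i : ℝ)))
    (K : Submodule ℂ (L2Rn n)) (hKclosed : IsClosed (K : Set (L2Rn n)))
    {d : ℕ} (ζs ζt : Fin d → L2Rn n)
    (hζsc : ∀ i, CompSupp (ζs i)) (hζtc : ∀ i, CompSupp (ζt i))
    (hdual : DualGFrames ν ζs ζt (K : Set (L2Rn n))) :
    ∃ (r : ℕ) (ηs ηt : Fin r → L2Rn n),
      (∀ i, CompSupp (ηs i) ∧ ηs i ∈ K) ∧
      (∀ i, CompSupp (ηt i) ∧ ηt i ∈ K) ∧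
      DualGFrames ν ηs ηt (K : Set (L2Rn n)) ∧
      BiOrth ν ηs ηt := by
  obtain ⟨hs, ht, hexp⟩ := hdual
  obtain ⟨r, η, ηt, B, hB, hη, hηt, hKν, hb, hb', h1, h2, h3⟩ :=
    exists_biorthogonal_frame (translation_zero hν) (translation_add hν)
      (S := compSuppSubmodule n) (fun g _ h => CompSupp.translation hν g h) hKclosed
      (fun _ h _ h' => CompSupp.finite_inner_translation_ne_zero hν h h') hζsc hζtc hs.1 ht.1
      hs.exists_isBessel fun m hm => (hexp m hm).2
  have hηK (g : Fin n → ℤ) (i : Fin r) : ν g (η i) ∈ K := hKν _ _ (hη i).2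
  have hηtK (g : Fin n → ℤ) (i : Fin r) : ν g (ηt i) ∈ K := hKν _ _ (hηt i).2
  exact ⟨r, η, ηt, hη, hηt, ⟨hb.isGFrame hB hb' hηK hηtK h2, hb'.isGFrame hB hb hηtK hηK h1,
    fun ζ hζ => ⟨h2 ζ hζ, h1 ζ hζ⟩⟩, h3⟩

end
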